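/- arXiv:0709.2696 — 3 statements merged into one kernel-verified Lean document; each statement's English description precedes it below -/
import Mathlib

section
/- Every finite Moufang loop M has a unique maximal normal subloop of group type: there is a normal subloop Gr(M) of group type that contains every normal subloop of M of group type. Moreover Gr(M/Gr(M)) = 1. -/
open Pointwise

/-- A Moufang loop: a loop (binary operation with two-sided identity in which the equations
`a * x = b` and `y * a = b` have unique solutions) satisfying the Moufang identity. -/
class MoufangLoop (M : Type*) extends Mul M, One M where
  one_mul : ∀ a : M, 1 * a = a
  mul_one : ∀ a : M, a * 1 = a
  existsUnique_mul_left : ∀ a b : M, ∃! x : M, a * x = b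
  existsUnique_mul_right : ∀ a b : M, ∃! y : M, y * a = b
  moufang : ∀ x y z : M, (x * y) * (z * x) = (x * (y * z)) * x

namespace MoufangLoop

variable {M : Type*} [MoufangLoop M]

/-- The unique solution `x` of `a * x = b` (left division). -/
noncomputable def lsol (a b : M) : M := (existsUnique_mul_left a b).exists.choose

/-- The unique solution `y` of `y * a = b` (right division). -/
noncomputable def rsol (a b : M) : M := (existsUnique_mul_right a b).exists.choose

theorem mul_lsol (a b : M) : a * lsol a b = b := (existsUnique_mul_left a b).exists.choose_spec

theorem rsol_mul (a b : M) : rsol a b * a = b := (existsUnique_mul_right a b).exists.choose_spec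

/-- A subloop: a subset closed under the loop operations (multiplication and the
two divisions; in particular it contains the identity). -/
def IsSubloopSet (A : Set M) : Prop :=
  (1 : M) ∈ A ∧ (∀ x ∈ A, ∀ y ∈ A, x * y ∈ A) ∧
    (∀ x ∈ A, ∀ y ∈ A, lsol x y ∈ A) ∧ ∀ x ∈ A, ∀ y ∈ A, rsol x y ∈ A

/-- `B` is a normal subloop of the (sub)loop `A`:  `B ⊆ A` and, for all `x, y ∈ A`,
`B*x = x*B`, `B*(x*y) = (B*x)*y` and `(x*B)*y = x*(B*y)` (as subsets). -/
def IsNormalIn (B A : Set M) : Prop :=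
  B ⊆ A ∧ (∀ x ∈ A, B * ({x} : Set M) = ({x} : Set M) * B) ∧
    (∀ x ∈ A, ∀ y ∈ A, B * ({x * y} : Set M) = B * ({x} : Set M) * ({y} : Set M)) ∧
    ∀ x ∈ A, ∀ y ∈ A, ({x} : Set M) * B * ({y} : Set M) = ({x} : Set M) * (B * ({y} : Set M))

/-- A composition series of the subloop `A` of `M`: a strictly decreasing chain of
subloops from `A` to `{1}`, each normal in the preceding one, such that each step is
a maximal normal subloop of the preceding one (equivalently, by the correspondence
theorem, each factor is a simple loop). -/
structure CompSeriesOn (M : Type*) [MoufangLoop M] (A : Set M) where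
  n : ℕ
  c : Fin (n + 1) → Set M
  subloop : ∀ i, IsSubloopSet (c i)
  first : c 0 = A
  last : c (Fin.last n) = {1}
  normal : ∀ i : Fin n, IsNormalIn (c i.succ) (c i.castSucc)
  proper : ∀ i : Fin n, c i.succ ≠ c i.castSucc
  maximal : ∀ i : Fin n, ∀ D : Set M, IsSubloopSet D → IsNormalIn D (c i.castSucc) →
    c i.succ ⊆ D → D = c i.succ ∨ D = c i.castSucc

/-- A composition series of the loop `M` itself. -/
abbrev CompSeries (M : Type*) [MoufangLoop M] := CompSeriesOn M Set.univ

/-- `f` realizes `Q` as the quotient of the subloop `A` of `M` by its normal subloop `B`: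
on `A`, `f` is multiplicative, maps onto `Q`, and its fibres are exactly the cosets of `B`.
Thus `Q` is isomorphic to the factor loop `A/B`. -/
def IsFactorMap {Q : Type*} [Mul Q] (A B : Set M) (f : M → Q) : Prop :=
  (∀ x ∈ A, ∀ y ∈ A, f (x * y) = f x * f y) ∧ (∀ q : Q, ∃ x ∈ A, f x = q) ∧
    ∀ x ∈ A, ∀ y ∈ A, (f x = f y ↔ x ∈ ({y} : Set M) * B)

/-- A `p`-Sylow subloop: a subloop of order `p ^ k` where `p ^ k` is the largest power
of `p` dividing the order of `M`. -/
def IsPSylowSubloop (p : ℕ) (A : Set M) : Prop :=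
  IsSubloopSet A ∧ Nat.card A = p ^ ((Nat.card M).factorization p)

end MoufangLoop

namespace MoufangLoop

variable {M : Type*} [MoufangLoop M]

/-- The composition factor `A/B` is associative, i.e. a group. -/
def FactorAssociative (A B : Set M) : Prop :=
  ∀ x ∈ A, ∀ y ∈ A, ∀ z ∈ A, (x * y) * z ∈ ({x * (y * z)} : Set M) * B

/-- The subloop `A` is of group type: all of its composition factors are groups. -/
def GroupTypeSet (A : Set M) : Prop :=
  ∀ (s : CompSeriesOn M A) (i : Fin s.n), FactorAssociative (s.c i.castSucc) (s.c i.succ)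

/-- Every normal subloop of `Q` of group type is trivial (i.e. `Gr(Q) = 1`). -/
def NoNontrivialGroupTypeNormal (Q : Type*) [MoufangLoop Q] : Prop :=
  ∀ D : Set Q, IsSubloopSet D → IsNormalIn D Set.univ → GroupTypeSet D → D = ({1} : Set Q)

end MoufangLoop

namespace MoufangLoop

section Congruence

variable {M : Type*} [MoufangLoop M] {A B C N : Set M} {r s : M → M → Prop}

theorem left_cancel {a x y : M} (h : a * x = a * y) : x = y :=
  (existsUnique_mul_left a (a * y)).unique h rfl

theorem right_cancel {a x y : M} (h : x * a = y * a) : x = y :=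
  (existsUnique_mul_right a (y * a)).unique h rfl

/-- `r` restricts to a loop congruence on `A`. -/
structure IsCong (A : Set M) (r : M → M → Prop) : Prop where
  refl : ∀ x ∈ A, r x x
  symm : ∀ x ∈ A, ∀ y ∈ A, r x y → r y x
  trans : ∀ x ∈ A, ∀ y ∈ A, ∀ z ∈ A, r x y → r y z → r x z
  mul : ∀ x ∈ A, ∀ x' ∈ A, ∀ y ∈ A, ∀ y' ∈ A, r x x' → r y y' → r (x * y) (x' * y')
  cancel_left : ∀ x ∈ A, ∀ y ∈ A, ∀ y' ∈ A, r (x * y) (x * y') → r y y'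
  cancel_right : ∀ x ∈ A, ∀ y ∈ A, ∀ y' ∈ A, r (y * x) (y' * x) → r y y'

theorem IsCong.mono (h : IsCong A r) (hB : B ⊆ A) : IsCong B r where
  refl x hx := h.refl x (hB hx)
  symm x hx y hy := h.symm x (hB hx) y (hB hy)
  trans x hx y hy z hz := h.trans x (hB hx) y (hB hy) z (hB hz)
  mul x hx x' hx' y hy y' hy' := h.mul x (hB hx) x' (hB hx') y (hB hy) y' (hB hy')
  cancel_left x hx y hy y' hy' := h.cancel_left x (hB hx) y (hB hy) y' (hB hy')
  cancel_right x hx y hy y' hy' := h.cancel_right x (hB hx) y (hB hy) y' (hB hy')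

/-- `B` is the class of the identity for the congruence `r` on `A`. -/
def IsKer (A : Set M) (r : M → M → Prop) (B : Set M) : Prop :=
  ∀ x, x ∈ B ↔ x ∈ A ∧ r x 1

theorem IsKer.mem_singleton_mul (hA : IsSubloopSet A) (hr : IsCong A r) (hk : IsKer A r B)
    {x y : M} (hy : y ∈ A) : x ∈ ({y} : Set M) * B ↔ x ∈ A ∧ r x y := by
  rw [Set.singleton_mul, Set.mem_image]
  constructor
  · rintro ⟨b, hb, rfl⟩
    obtain ⟨hbA, hb1⟩ := (hk b).1 hb
    refine ⟨hA.2.1 _ hy _ hbA, ?_⟩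
    simpa only [mul_one] using hr.mul y hy y hy b hbA 1 hA.1 (hr.refl y hy) hb1
  · rintro ⟨hx, hxy⟩
    have hl := hA.2.2.1 y hy x hx
    refine ⟨lsol y x, (hk _).2 ⟨hl, hr.cancel_left y hy _ hl 1 hA.1 ?_⟩, mul_lsol y x⟩
    rwa [mul_lsol, mul_one]

theorem IsKer.mem_mul_singleton (hA : IsSubloopSet A) (hr : IsCong A r) (hk : IsKer A r B)
    {x y : M} (hy : y ∈ A) : x ∈ B * ({y} : Set M) ↔ x ∈ A ∧ r x y := by
  rw [Set.mul_singleton, Set.mem_image]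
  constructor
  · rintro ⟨b, hb, rfl⟩
    obtain ⟨hbA, hb1⟩ := (hk b).1 hb
    refine ⟨hA.2.1 _ hbA _ hy, ?_⟩
    simpa only [one_mul] using hr.mul b hbA 1 hA.1 y hy y hy hb1 (hr.refl y hy)
  · rintro ⟨hx, hxy⟩
    have hl := hA.2.2.2 y hy x hx
    refine ⟨rsol y x, (hk _).2 ⟨hl, hr.cancel_right y hy _ hl 1 hA.1 ?_⟩, rsol_mul y x⟩
    rwa [rsol_mul, one_mul]

theorem IsKer.isSubloopSet (hA : IsSubloopSet A) (hr : IsCong A r) (hk : IsKer A r B) :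
    IsSubloopSet B := by
  refine ⟨(hk 1).2 ⟨hA.1, hr.refl 1 hA.1⟩, fun x hx y hy => ?_, fun x hx y hy => ?_,
    fun x hx y hy => ?_⟩
  all_goals
    rw [hk] at hx hy ⊢
    obtain ⟨hx, hx1⟩ := hx
    obtain ⟨hy, hy1⟩ := hy
  · refine ⟨hA.2.1 x hx y hy, ?_⟩
    simpa only [one_mul] using hr.mul x hx 1 hA.1 y hy 1 hA.1 hx1 hy1
  · have hl := hA.2.2.1 x hx y hy
    refine ⟨hl, hr.cancel_left x hx _ hl 1 hA.1 ?_⟩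
    rw [mul_lsol, mul_one]
    exact hr.trans y hy 1 hA.1 x hx hy1 (hr.symm x hx 1 hA.1 hx1)
  · have hl := hA.2.2.2 x hx y hy
    refine ⟨hl, hr.cancel_right x hx _ hl 1 hA.1 ?_⟩
    rw [rsol_mul, one_mul]
    exact hr.trans y hy 1 hA.1 x hx hy1 (hr.symm x hx 1 hA.1 hx1)

theorem IsKer.isNormalIn (hA : IsSubloopSet A) (hr : IsCong A r) (hk : IsKer A r B) :
    IsNormalIn B A := by
  have left_translate : ∀ S : Set M, ∀ x ∈ A, ∀ y ∈ A, (∀ z, z ∈ S ↔ z ∈ A ∧ r z y) →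
      ∀ z, z ∈ ({x} : Set M) * S ↔ z ∈ A ∧ r z (x * y) := by
    intro S x hx y hy hS z
    rw [Set.singleton_mul, Set.mem_image]
    constructor
    · rintro ⟨w, hw, rfl⟩
      obtain ⟨hw, hwy⟩ := (hS w).1 hw
      exact ⟨hA.2.1 _ hx _ hw, hr.mul x hx x hx w hw y hy (hr.refl x hx) hwy⟩
    · rintro ⟨hz, hzxy⟩
      have hl := hA.2.2.1 x hx z hz
      exact ⟨lsol x z, (hS _).2 ⟨hl, hr.cancel_left x hx _ hl y hy (by rwa [mul_lsol])⟩,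
        mul_lsol x z⟩
  have right_translate : ∀ S : Set M, ∀ x ∈ A, ∀ y ∈ A, (∀ z, z ∈ S ↔ z ∈ A ∧ r z x) →
      ∀ z, z ∈ S * ({y} : Set M) ↔ z ∈ A ∧ r z (x * y) := by
    intro S x hx y hy hS z
    rw [Set.mul_singleton, Set.mem_image]
    constructor
    · rintro ⟨w, hw, rfl⟩
      obtain ⟨hw, hwx⟩ := (hS w).1 hw
      exact ⟨hA.2.1 _ hw _ hy, hr.mul w hw x hx y hy y hy hwx (hr.refl y hy)⟩
    · rintro ⟨hz, hzxy⟩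
      have hl := hA.2.2.2 y hy z hz
      exact ⟨rsol y z, (hS _).2 ⟨hl, hr.cancel_right y hy _ hl x hx (by rwa [rsol_mul])⟩,
        rsol_mul y z⟩
  refine ⟨fun x hx => ((hk x).1 hx).1, fun x hx => ?_, fun x hx y hy => ?_, fun x hx y hy => ?_⟩
  · ext z
    rw [hk.mem_mul_singleton hA hr hx, hk.mem_singleton_mul hA hr hx]
  · ext z
    rw [hk.mem_mul_singleton hA hr (hA.2.1 x hx y hy),
      right_translate _ x hx y hy fun z => hk.mem_mul_singleton hA hr hx]
  · ext z
    rw [right_translate _ x hx y hy fun z => hk.mem_singleton_mul hA hr hx,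
      left_translate _ x hx y hy fun z => hk.mem_mul_singleton hA hr hy]

theorem singleton_mul_injective (x : M) : Function.Injective fun S : Set M => ({x} : Set M) * S := by
  intro S T h
  simp only [Set.singleton_mul] at h
  exact Set.image_injective.2 (fun _ _ => left_cancel) h

theorem mul_singleton_injective (x : M) : Function.Injective fun S : Set M => S * ({x} : Set M) := by
  intro S T h
  simp only [Set.mul_singleton] at h
  exact Set.image_injective.2 (fun _ _ => right_cancel) h

/-- A normal subloop is the kernel of the congruence given by its cosets. -/
theorem IsNormalIn.exists_isCong (hA : IsSubloopSet A) (hB : IsSubloopSet B)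
    (h : IsNormalIn B A) : ∃ r, IsCong A r ∧ IsKer A r B := by
  obtain ⟨hBA, hcomm, hright, hmid⟩ := h
  have hl : ∀ x ∈ A, ∀ y ∈ A,
      ({x * y} : Set M) * B = ({x} : Set M) * (({y} : Set M) * B) := by
    intro x hx y hy
    rw [← hcomm _ (hA.2.1 x hx y hy), hright x hx y hy, hcomm x hx, hmid x hx y hy, hcomm y hy]
  have hr : ∀ x ∈ A, ∀ y ∈ A,
      ({x * y} : Set M) * B = ({x} : Set M) * B * ({y} : Set M) := by
    intro x hx y hy
    rw [← hcomm _ (hA.2.1 x hx y hy), hright x hx y hy, hcomm x hx]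
  refine ⟨fun x y => ({x} : Set M) * B = ({y} : Set M) * B, ⟨fun _ _ => rfl,
    fun _ _ _ _ h => h.symm, fun _ _ _ _ _ _ h h' => h.trans h', ?_, ?_, ?_⟩, ?_⟩
  · intro x hx x' hx' y hy y' hy' h h'
    rw [hl x hx y hy, h', ← hl x hx y' hy', hr x hx y' hy', h, hr x' hx' y' hy']
  · intro x hx y hy y' hy' h
    rw [hl x hx y hy, hl x hx y' hy'] at h
    exact singleton_mul_injective x h
  · intro x hx y hy y' hy' h
    rw [hr y hy x hx, hr y' hy' x hx] at h
    exact mul_singleton_injective x h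
  · intro x
    have h1 : ({1} : Set M) * B = B := by simp [Set.singleton_mul, one_mul]
    beta_reduce
    rw [h1]
    constructor
    · refine fun hx => ⟨hBA hx, ?_⟩
      ext z
      rw [Set.singleton_mul, Set.mem_image]
      constructor
      · rintro ⟨b, hb, rfl⟩
        exact hB.2.1 x hx b hb
      · exact fun hz => ⟨lsol x z, hB.2.2.1 x hx z hz, mul_lsol x z⟩
    · rintro ⟨-, h⟩
      rw [← h, Set.singleton_mul]
      exact ⟨1, hB.1, mul_one x⟩

theorem factorAssociative_iff (hA : IsSubloopSet A) (hr : IsCong A r) (hk : IsKer A r B) :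
    FactorAssociative A B ↔
      ∀ x ∈ A, ∀ y ∈ A, ∀ z ∈ A, r ((x * y) * z) (x * (y * z)) := by
  refine forall₂_congr fun x hx => forall₂_congr fun y hy => forall₂_congr fun z hz => ?_
  rw [hk.mem_singleton_mul hA hr (hA.2.1 x hx _ (hA.2.1 y hy z hz))]
  exact and_iff_right (hA.2.1 _ (hA.2.1 x hx y hy) z hz)

theorem isSubloopSet_univ : IsSubloopSet (Set.univ : Set M) := by
  simp [IsSubloopSet]

theorem isCong_eq (A : Set M) : IsCong A (· = ·) where
  refl _ _ := rfl
  symm _ _ _ _ := Eq.symm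
  trans _ _ _ _ _ _ := Eq.trans
  mul _ _ _ _ _ _ _ _ h h' := by rw [h, h']
  cancel_left _ _ _ _ _ _ := left_cancel
  cancel_right _ _ _ _ _ _ := right_cancel

theorem isKer_one (hA : IsSubloopSet A) : IsKer A (· = ·) {1} := by
  intro x
  rw [Set.mem_singleton_iff]
  exact ⟨fun h => ⟨h ▸ hA.1, h⟩, And.right⟩

theorem isSubloopSet_one : IsSubloopSet ({1} : Set M) :=
  (isKer_one isSubloopSet_univ).isSubloopSet isSubloopSet_univ (isCong_eq _)

theorem isNormalIn_one (hA : IsSubloopSet A) : IsNormalIn {1} A :=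
  (isKer_one hA).isNormalIn hA (isCong_eq _)

/-- The union of the classes of the congruence `r` on `C` that meet `A`. -/
def saturation (C : Set M) (r : M → M → Prop) (A : Set M) : Set M :=
  {z | z ∈ C ∧ ∃ a ∈ A, r z a}

/-- The relation on the saturation of `A` generated by `r` and the congruence `s` on `A`. -/
def joinRel (r : M → M → Prop) (A : Set M) (s : M → M → Prop) (z w : M) : Prop :=
  ∃ a ∈ A, ∃ b ∈ A, r z a ∧ s a b ∧ r w b

theorem subset_saturation (hr : IsCong C r) (hAC : A ⊆ C) : A ⊆ saturation C r A :=
  fun a ha => ⟨hAC ha, a, ha, hr.refl a (hAC ha)⟩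

theorem saturation_eq_self (hr : IsCong C r) : saturation C r C = C :=
  Set.Subset.antisymm (fun _ h => h.1) (subset_saturation hr subset_rfl)

theorem saturation_one (hk : IsKer C r N) : saturation C r {1} = N := by
  ext z
  simp [saturation, hk z]

theorem IsKer.subset_saturation (hk : IsKer C r N) (hA : (1 : M) ∈ A) :
    N ⊆ saturation C r A :=
  fun x hx => ⟨((hk x).1 hx).1, 1, hA, ((hk x).1 hx).2⟩

theorem IsSubloopSet.saturation (hC : IsSubloopSet C) (hr : IsCong C r) (hA : IsSubloopSet A)
    (hAC : A ⊆ C) : IsSubloopSet (saturation C r A) := by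
  refine ⟨MoufangLoop.subset_saturation hr hAC hA.1, ?_, ?_, ?_⟩
  all_goals
    rintro x ⟨hx, a, ha, hxa⟩ y ⟨hy, b, hb, hyb⟩
  · exact ⟨hC.2.1 x hx y hy, a * b, hA.2.1 a ha b hb,
      hr.mul x hx a (hAC ha) y hy b (hAC hb) hxa hyb⟩
  · have hl := hC.2.2.1 x hx y hy
    have hl' := hA.2.2.1 a ha b hb
    refine ⟨hl, _, hl', hr.cancel_left a (hAC ha) _ hl _ (hAC hl') ?_⟩
    have := hr.mul a (hAC ha) x hx _ hl _ hl (hr.symm x hx a (hAC ha) hxa) (hr.refl _ hl)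
    rw [mul_lsol] at this ⊢
    exact hr.trans _ (hC.2.1 _ (hAC ha) _ hl) y hy b (hAC hb) this hyb
  · have hl := hC.2.2.2 x hx y hy
    have hl' := hA.2.2.2 a ha b hb
    refine ⟨hl, _, hl', hr.cancel_right a (hAC ha) _ hl _ (hAC hl') ?_⟩
    have := hr.mul _ hl _ hl a (hAC ha) x hx (hr.refl _ hl) (hr.symm x hx a (hAC ha) hxa)
    rw [rsol_mul] at this ⊢
    exact hr.trans _ (hC.2.1 _ hl _ (hAC ha)) y hy b (hAC hb) this hyb

/-- Congruences on a loop permute. -/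
theorem IsCong.exists_permute (hA : IsSubloopSet A) (hs : IsCong A s) (hr : IsCong A r)
    {a b c : M} (ha : a ∈ A) (hb : b ∈ A) (hc : c ∈ A) (hab : s a b) (hbc : r b c) :
    ∃ d ∈ A, r a d ∧ s d c := by
  have hu := hA.2.2.1 b hb c hc
  have hu1 : r 1 (lsol b c) :=
    hr.cancel_left b hb 1 hA.1 _ hu (by rwa [mul_lsol, mul_one])
  refine ⟨a * lsol b c, hA.2.1 a ha _ hu, ?_, ?_⟩
  · simpa only [mul_one] using hr.mul a ha a ha 1 hA.1 _ hu (hr.refl a ha) hu1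
  · simpa only [mul_lsol] using hs.mul a ha b hb _ hu _ hu hab (hs.refl _ hu)

theorem IsCong.joinRel (hC : IsSubloopSet C) (hr : IsCong C r) (hA : IsSubloopSet A)
    (hAC : A ⊆ C) (hs : IsCong A s) : IsCong (saturation C r A) (joinRel r A s) := by
  have htrans : ∀ x ∈ C, ∀ a ∈ A, ∀ b ∈ A, ∀ y ∈ C, ∀ b' ∈ A, ∀ c ∈ A, ∀ z ∈ C,
      r x a → s a b → r y b → r y b' → s b' c → r z c → MoufangLoop.joinRel r A s x z := by
    intro x hx a ha b hb y hy b' hb' c hc z hz hxa hab hyb hyb' hbc hzc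
    obtain ⟨d, hd, had, hdb⟩ := IsCong.exists_permute hA hs (hr.mono hAC) ha hb hb' hab
      (hr.trans b (hAC hb) y hy b' (hAC hb') (hr.symm _ hy _ (hAC hb) hyb) hyb')
    exact ⟨d, hd, c, hc, hr.trans x hx a (hAC ha) d (hAC hd) hxa had,
      hs.trans d hd b' hb' c hc hdb hbc, hzc⟩
  refine ⟨?_, ?_, ?_, ?_, ?_, ?_⟩
  · rintro x ⟨hx, a, ha, hxa⟩
    exact ⟨a, ha, a, ha, hxa, hs.refl a ha, hxa⟩
  · rintro x - y - ⟨a, ha, b, hb, hxa, hab, hyb⟩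
    exact ⟨b, hb, a, ha, hyb, hs.symm a ha b hb hab, hxa⟩
  · rintro x ⟨hx, -⟩ y ⟨hy, -⟩ z ⟨hz, -⟩ ⟨a, ha, b, hb, hxa, hab, hyb⟩
      ⟨b', hb', c, hc, hyb', hbc, hzc⟩
    exact htrans x hx a ha b hb y hy b' hb' c hc z hz hxa hab hyb hyb' hbc hzc
  · rintro x ⟨hx, -⟩ x' ⟨hx', -⟩ y ⟨hy, -⟩ y' ⟨hy', -⟩ ⟨a, ha, a', ha', hxa, haa, hxa'⟩
      ⟨b, hb, b', hb', hyb, hbb, hyb'⟩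
    exact ⟨a * b, hA.2.1 a ha b hb, a' * b', hA.2.1 a' ha' b' hb',
      hr.mul x hx a (hAC ha) y hy b (hAC hb) hxa hyb,
      hs.mul a ha a' ha' b hb b' hb' haa hbb,
      hr.mul x' hx' a' (hAC ha') y' hy' b' (hAC hb') hxa' hyb'⟩
  · rintro x ⟨hx, x₀, hx₀, hxx⟩ y ⟨hy, -⟩ y' ⟨hy', -⟩ ⟨a, ha, b, hb, hxa, hab, hyb⟩
    have key : ∀ y ∈ C, ∀ a ∈ A, r (x * y) a → r y (lsol x₀ a) := by
      intro y hy a ha h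
      have hl := hAC (hA.2.2.1 x₀ hx₀ a ha)
      refine hr.cancel_left x₀ (hAC hx₀) y hy _ hl ?_
      rw [mul_lsol]
      exact hr.trans _ (hC.2.1 _ (hAC hx₀) _ hy) _ (hC.2.1 _ hx _ hy) _ (hAC ha)
        (hr.mul _ (hAC hx₀) _ hx _ hy _ hy (hr.symm _ hx _ (hAC hx₀) hxx) (hr.refl _ hy)) h
    have hl := hA.2.2.1 x₀ hx₀ a ha
    have hl' := hA.2.2.1 x₀ hx₀ b hb
    refine ⟨_, hl, _, hl', key y hy a ha hxa, ?_, key y' hy' b hb hyb⟩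
    exact hs.cancel_left x₀ hx₀ _ hl _ hl' (by rwa [mul_lsol, mul_lsol])
  · rintro x ⟨hx, x₀, hx₀, hxx⟩ y ⟨hy, -⟩ y' ⟨hy', -⟩ ⟨a, ha, b, hb, hxa, hab, hyb⟩
    have key : ∀ y ∈ C, ∀ a ∈ A, r (y * x) a → r y (rsol x₀ a) := by
      intro y hy a ha h
      have hl := hAC (hA.2.2.2 x₀ hx₀ a ha)
      refine hr.cancel_right x₀ (hAC hx₀) y hy _ hl ?_
      rw [rsol_mul]
      exact hr.trans _ (hC.2.1 _ hy _ (hAC hx₀)) _ (hC.2.1 _ hy _ hx) _ (hAC ha)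
        (hr.mul _ hy _ hy _ (hAC hx₀) _ hx (hr.refl _ hy) (hr.symm _ hx _ (hAC hx₀) hxx)) h
    have hl := hA.2.2.2 x₀ hx₀ a ha
    have hl' := hA.2.2.2 x₀ hx₀ b hb
    refine ⟨_, hl, _, hl', key y hy a ha hxa, ?_, key y' hy' b hb hyb⟩
    exact hs.cancel_right x₀ hx₀ _ hl _ hl' (by rwa [rsol_mul, rsol_mul])

theorem IsKer.saturation (hC : IsSubloopSet C) (hr : IsCong C r) (hA : IsSubloopSet A)
    (hAC : A ⊆ C) (hs : IsCong A s) (hk : IsKer A s B) :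
    IsKer (saturation C r A) (joinRel r A s) (saturation C r B) := by
  intro z
  constructor
  · rintro ⟨hz, b, hb, hzb⟩
    obtain ⟨hbA, hb1⟩ := (hk b).1 hb
    exact ⟨⟨hz, b, hbA, hzb⟩, b, hbA, 1, hA.1, hzb, hb1, hr.refl 1 hC.1⟩
  · rintro ⟨⟨hz, -⟩, a, ha, b, hb, hza, hab, h1b⟩
    obtain ⟨d, hd, had, hd1⟩ := IsCong.exists_permute hA hs (hr.mono hAC) ha hb hA.1 hab
      (hr.symm 1 hC.1 b (hAC hb) h1b)
    exact ⟨hz, d, (hk d).2 ⟨hd, hd1⟩, hr.trans z hz a (hAC ha) d (hAC hd) hza had⟩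

theorem FactorAssociative.saturation (hC : IsSubloopSet C) (hr : IsCong C r)
    (hA : IsSubloopSet A) (hAC : A ⊆ C) (hs : IsCong A s) (hk : IsKer A s B)
    (h : FactorAssociative A B) :
    FactorAssociative (saturation C r A) (saturation C r B) := by
  rw [factorAssociative_iff hA hs hk] at h
  rw [factorAssociative_iff (hC.saturation hr hA hAC) (hr.joinRel hC hA hAC hs)
    (hk.saturation hC hr hA hAC hs)]
  rintro x ⟨hx, a, ha, hxa⟩ y ⟨hy, b, hb, hyb⟩ z ⟨hz, c, hc, hzc⟩
  exact ⟨(a * b) * c, hA.2.1 _ (hA.2.1 a ha b hb) c hc, a * (b * c),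
    hA.2.1 a ha _ (hA.2.1 b hb c hc),
    hr.mul _ (hC.2.1 x hx y hy) _ (hAC (hA.2.1 a ha b hb)) z hz c (hAC hc)
      (hr.mul x hx a (hAC ha) y hy b (hAC hb) hxa hyb) hzc,
    h a ha b hb c hc,
    hr.mul x hx a (hAC ha) _ (hC.2.1 y hy z hz) _ (hAC (hA.2.1 b hb c hc)) hxa
      (hr.mul y hy b (hAC hb) z hz c (hAC hc) hyb hzc)⟩

end Congruence

section AssocChain

variable {M : Type*} [MoufangLoop M] {A B C D N S : Set M} {r : M → M → Prop}

/-- `A` is joined to `N` by a subnormal chain of subloops with associative factors. -/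
inductive AssocChain (N : Set M) : Set M → Prop
  | refl : AssocChain N N
  | step {A B : Set M} : IsSubloopSet A → IsSubloopSet B → IsNormalIn B A →
      FactorAssociative A B → AssocChain N B → AssocChain N A

theorem AssocChain.trans (h : AssocChain N A) (h' : AssocChain A B) : AssocChain N B := by
  induction h' with
  | refl => exact h
  | step hA hB hn ha _ ih => exact .step hA hB hn ha ih

theorem AssocChain.subloop_of_one (h : AssocChain {1} A) (hS : IsSubloopSet S) (hSA : S ⊆ A) :
    AssocChain {1} S := by
  induction h generalizing S with
  | refl =>
    obtain rfl : S = {1} := hSA.antisymm (Set.singleton_subset_iff.2 hS.1)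
    exact .refl
  | @step A B hA hB hn ha _ ih =>
    obtain ⟨r, hr, hk⟩ := hn.exists_isCong hA hB
    have hrS := hr.mono hSA
    have hkS : IsKer S r (B ∩ S) := fun x => by
      rw [Set.mem_inter_iff, hk x]
      exact ⟨fun h => ⟨h.2, h.1.2⟩, fun h => ⟨⟨hSA h.1, h.2⟩, h.1⟩⟩
    have hsub := hkS.isSubloopSet hS hrS
    refine .step hS hsub (hkS.isNormalIn hS hrS) ?_ (ih hsub Set.inter_subset_left)
    rw [factorAssociative_iff hS hrS hkS]
    rw [factorAssociative_iff hA hr hk] at ha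
    exact fun x hx y hy z hz => ha x (hSA hx) y (hSA hy) z (hSA hz)

theorem AssocChain.saturation (hC : IsSubloopSet C) (hr : IsCong C r) (h : AssocChain N A)
    (hAC : A ⊆ C) : AssocChain (saturation C r N) (saturation C r A) := by
  induction h with
  | refl => exact .refl
  | step hA hB hn ha _ ih =>
    obtain ⟨s, hs, hk⟩ := hn.exists_isCong hA hB
    exact .step (hC.saturation hr hA hAC) (hC.saturation hr hB (hn.1.trans hAC))
      ((hk.saturation hC hr hA hAC hs).isNormalIn (hC.saturation hr hA hAC)
        (hr.joinRel hC hA hAC hs))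
      (ha.saturation hC hr hA hAC hs hk) (ih (hn.1.trans hAC))

theorem AssocChain.factorAssociative_of_maximal (hC : IsSubloopSet C) (hD : IsSubloopSet D)
    (hDC : IsNormalIn D C)
    (hmax : ∀ E : Set M, IsSubloopSet E → IsNormalIn E C → D ⊆ E → E = D ∨ E = C)
    (h : AssocChain {1} C) : FactorAssociative C D := by
  obtain ⟨r, hr, hk⟩ := hDC.exists_isCong hC hD
  suffices ∀ A, AssocChain {1} A → A ⊆ C → MoufangLoop.saturation C r A = C → FactorAssociative C D from
    this C h subset_rfl (saturation_eq_self hr)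
  intro A hA
  induction hA with
  | refl =>
    intro _ h
    rw [saturation_one hk] at h
    subst h
    intro x hx y hy z hz
    rw [hk.mem_singleton_mul hC hr (hC.2.1 x hx _ (hC.2.1 y hy z hz))]
    have h₁ := hC.2.1 _ (hC.2.1 x hx y hy) z hz
    have h₂ := hC.2.1 x hx _ (hC.2.1 y hy z hz)
    exact ⟨h₁, hr.trans _ h₁ 1 hC.1 _ h₂ ((hk _).1 h₁).2
      (hr.symm _ h₂ 1 hC.1 ((hk _).1 h₂).2)⟩
  | @step A B hA hB hn ha _ ih =>
    intro hAC hsat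
    obtain ⟨s, hs, hks⟩ := hn.exists_isCong hA hB
    have hBC := hn.1.trans hAC
    have hnorm := (hks.saturation hC hr hA hAC hs).isNormalIn (hC.saturation hr hA hAC)
        (hr.joinRel hC hA hAC hs)
    have hass := ha.saturation hC hr hA hAC hs hks
    rw [hsat] at hnorm hass
    rcases hmax _ (hC.saturation hr hB hBC) hnorm (hk.subset_saturation hB.1) with h | h
    · rwa [h] at hass
    · exact ih hBC h

theorem CompSeriesOn.subset (s : CompSeriesOn M A) (i : Fin (s.n + 1)) : s.c i ⊆ A := by
  induction i using Fin.induction with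
  | zero => exact s.first.subset
  | succ i ih => exact (s.normal i).1.trans ih

theorem AssocChain.groupTypeSet (h : AssocChain {1} A) : GroupTypeSet A := fun s i =>
  (h.subloop_of_one (s.subloop _) (s.subset _)).factorAssociative_of_maximal (s.subloop _)
    (s.subloop _) (s.normal i) (s.maximal i)

/-- Prepend a subloop to a composition series of one of its maximal normal subloops. -/
def CompSeriesOn.cons (s : CompSeriesOn M B) (hA : IsSubloopSet A) (hn : IsNormalIn B A)
    (hne : B ≠ A)
    (hmax : ∀ D : Set M, IsSubloopSet D → IsNormalIn D A → B ⊆ D → D = B ∨ D = A) :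
    CompSeriesOn M A where
  n := s.n + 1
  c := Fin.cons A s.c
  subloop i := by
    refine Fin.cases ?_ (fun i => ?_) i
    · exact hA
    · exact s.subloop i
  first := rfl
  last := s.last
  normal i := by
    refine Fin.cases ?_ (fun i => ?_) i
    · simpa [s.first] using hn
    · simpa [← Fin.succ_castSucc] using s.normal i
  proper i := by
    refine Fin.cases ?_ (fun i => ?_) i
    · simpa [s.first] using hne
    · simpa [← Fin.succ_castSucc] using s.proper i
  maximal i := by
    refine Fin.cases ?_ (fun i => ?_) i
    · simpa [s.first] using hmax
    · simpa [← Fin.succ_castSucc] using s.maximal i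

theorem exists_compSeriesOn [Finite M] (A : Set M) (hA : IsSubloopSet A) :
    Nonempty (CompSeriesOn M A) := by
  induction A using WellFoundedLT.induction with
  | ind A ih =>
    by_cases h1 : A = {1}
    · exact ⟨⟨0, fun _ => A, fun _ => hA, rfl, h1, fun i => i.elim0, fun i => i.elim0,
        fun i => i.elim0⟩⟩
    · obtain ⟨B, hB⟩ := (Set.toFinite {B : Set M | IsSubloopSet B ∧ IsNormalIn B A ∧ B ≠ A}
        ).exists_maximal ⟨{1}, isSubloopSet_one, isNormalIn_one hA, Ne.symm h1⟩
      obtain ⟨⟨hBs, hBn, hBA⟩, hmax⟩ := hB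
      obtain ⟨s⟩ := ih B (hBn.1.lt_of_ne hBA) hBs
      refine ⟨s.cons hA hBn hBA fun D hD hDn hBD => ?_⟩
      by_cases hDA : D = A
      · exact .inr hDA
      · exact .inl ((hmax ⟨hD, hDn, hDA⟩ hBD).antisymm hBD)

theorem GroupTypeSet.assocChain [Finite M] (hA : IsSubloopSet A) (h : GroupTypeSet A) :
    AssocChain {1} A := by
  obtain ⟨s⟩ := exists_compSeriesOn A hA
  rw [← s.first]
  generalize (0 : Fin (s.n + 1)) = i
  induction i using Fin.reverseInduction with
  | last => rw [s.last]; exact .refl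
  | cast i ih => exact .step (s.subloop _) (s.subloop _) (s.normal i) (h s i) ih

theorem AssocChain.mul_normal (hN : IsSubloopSet N) (hNn : IsNormalIn N Set.univ)
    (hNc : AssocChain {1} N) (hA : IsSubloopSet A) (hAn : IsNormalIn A Set.univ)
    (hAc : AssocChain {1} A) :
    ∃ P : Set M, IsSubloopSet P ∧ IsNormalIn P Set.univ ∧ AssocChain {1} P ∧ N ⊆ P ∧ A ⊆ P := by
  have hU := isSubloopSet_univ (M := M)
  obtain ⟨r, hr, hk⟩ := hNn.exists_isCong hU hN
  obtain ⟨s, hs, hks⟩ := hAn.exists_isCong hU hA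
  refine ⟨MoufangLoop.saturation Set.univ r A, hU.saturation hr hA (Set.subset_univ _), ?_, ?_,
    hk.subset_saturation hA.1, MoufangLoop.subset_saturation hr (Set.subset_univ _)⟩
  · have := (hks.saturation hU hr hU subset_rfl hs).isNormalIn (hU.saturation hr hU subset_rfl)
        (hr.joinRel hU hU subset_rfl hs)
    rwa [saturation_eq_self hr] at this
  · refine hNc.trans ?_
    have := hAc.saturation hU hr (Set.subset_univ _)
    rwa [saturation_one hk] at this

end AssocChain

section Preimage

variable {M Q : Type*} [MoufangLoop M] [MoufangLoop Q] {f : M → Q} {A B N : Set Q}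
  {r : Q → Q → Prop}

theorem map_one_of_map_mul (hf : ∀ x y, f (x * y) = f x * f y) : f 1 = 1 := by
  apply left_cancel (a := f 1)
  rw [← hf, mul_one, mul_one]

theorem IsSubloopSet.preimage (hf : ∀ x y, f (x * y) = f x * f y) (hA : IsSubloopSet A) :
    IsSubloopSet (f ⁻¹' A) := by
  refine ⟨?_, fun x hx y hy => ?_, fun x hx y hy => ?_, fun x hx y hy => ?_⟩
  · rw [Set.mem_preimage, map_one_of_map_mul hf]
    exact hA.1
  · rw [Set.mem_preimage, hf]
    exact hA.2.1 _ hx _ hy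
  · have : f (lsol x y) = lsol (f x) (f y) := by
      apply left_cancel (a := f x)
      rw [← hf, mul_lsol, mul_lsol]
    rw [Set.mem_preimage, this]
    exact hA.2.2.1 _ hx _ hy
  · have : f (rsol x y) = rsol (f x) (f y) := by
      apply right_cancel (a := f x)
      rw [← hf, rsol_mul, rsol_mul]
    rw [Set.mem_preimage, this]
    exact hA.2.2.2 _ hx _ hy

theorem IsCong.preimage (hf : ∀ x y, f (x * y) = f x * f y) (hr : IsCong A r) :
    IsCong (f ⁻¹' A) fun x y => r (f x) (f y) where
  refl x hx := hr.refl _ hx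
  symm x hx y hy := hr.symm _ hx _ hy
  trans x hx y hy z hz := hr.trans _ hx _ hy _ hz
  mul x hx x' hx' y hy y' hy' := by
    rw [hf, hf]
    exact hr.mul _ hx _ hx' _ hy _ hy'
  cancel_left x hx y hy y' hy' := by
    rw [hf, hf]
    exact hr.cancel_left _ hx _ hy _ hy'
  cancel_right x hx y hy y' hy' := by
    rw [hf, hf]
    exact hr.cancel_right _ hx _ hy _ hy'

theorem IsKer.preimage (hf : ∀ x y, f (x * y) = f x * f y) (hk : IsKer A r B) :
    IsKer (f ⁻¹' A) (fun x y => r (f x) (f y)) (f ⁻¹' B) := fun x => by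
  beta_reduce
  rw [map_one_of_map_mul hf]
  exact hk (f x)

theorem IsNormalIn.preimage (hf : ∀ x y, f (x * y) = f x * f y) (hA : IsSubloopSet A)
    (hB : IsSubloopSet B) (h : IsNormalIn B A) : IsNormalIn (f ⁻¹' B) (f ⁻¹' A) := by
  obtain ⟨r, hr, hk⟩ := h.exists_isCong hA hB
  exact (hk.preimage hf).isNormalIn (hA.preimage hf) (hr.preimage hf)

theorem AssocChain.preimage (hf : ∀ x y, f (x * y) = f x * f y) (h : AssocChain N A) :
    AssocChain (f ⁻¹' N) (f ⁻¹' A) := by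
  induction h with
  | refl => exact .refl
  | step hA hB hn ha _ ih =>
    refine .step (hA.preimage hf) (hB.preimage hf) (hn.preimage hf hA hB) ?_ ih
    obtain ⟨r, hr, hk⟩ := hn.exists_isCong hA hB
    rw [factorAssociative_iff hA hr hk] at ha
    rw [factorAssociative_iff (hA.preimage hf) (hr.preimage hf) (hk.preimage hf)]
    intro x hx y hy z hz
    simp only [hf]
    exact ha _ hx _ hy _ hz

end Preimage

end MoufangLoop

/-- Every finite Moufang loop `M` has a unique maximal normal subloop of group type
`Gr(M)` (containing every normal subloop of group type); moreover `Gr(M/Gr(M)) = 1`. -/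
theorem group_type_radical (M : Type) [MoufangLoop M] [Finite M] :
    (∃! G0 : Set M,
      MoufangLoop.IsSubloopSet G0 ∧ MoufangLoop.IsNormalIn G0 Set.univ ∧
        MoufangLoop.GroupTypeSet G0 ∧
        ∀ N : Set M, MoufangLoop.IsSubloopSet N → MoufangLoop.IsNormalIn N Set.univ →
          MoufangLoop.GroupTypeSet N → N ⊆ G0) ∧
    ∀ G0 : Set M,
      (MoufangLoop.IsSubloopSet G0 ∧ MoufangLoop.IsNormalIn G0 Set.univ ∧
        MoufangLoop.GroupTypeSet G0 ∧
        ∀ N : Set M, MoufangLoop.IsSubloopSet N → MoufangLoop.IsNormalIn N Set.univ →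
          MoufangLoop.GroupTypeSet N → N ⊆ G0) →
      ∀ (Q : Type) (iQ : MoufangLoop Q) (f : M → Q),
        @MoufangLoop.IsFactorMap M _ Q iQ.toMul Set.univ G0 f →
          @MoufangLoop.NoNontrivialGroupTypeNormal Q iQ := by
  open MoufangLoop in
  constructor
  · obtain ⟨G, ⟨hG, hGn, hGc⟩, hmax⟩ := (Set.toFinite {B : Set M | IsSubloopSet B ∧
      IsNormalIn B Set.univ ∧ AssocChain {1} B}).exists_maximal
        ⟨{1}, isSubloopSet_one, isNormalIn_one isSubloopSet_univ, .refl⟩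
    have hcontains : ∀ N : Set M, IsSubloopSet N → IsNormalIn N Set.univ →
        GroupTypeSet N → N ⊆ G := by
      intro N hN hNn hNg
      obtain ⟨P, hP, hPn, hPc, hNP, hGP⟩ :=
        AssocChain.mul_normal hN hNn (hNg.assocChain hN) hG hGn hGc
      exact hNP.trans (hmax ⟨hP, hPn, hPc⟩ hGP)
    refine ⟨G, ⟨hG, hGn, hGc.groupTypeSet, hcontains⟩, ?_⟩
    rintro G' ⟨hG', hGn', hGg', hcontains'⟩
    exact (hcontains G' hG' hGn' hGg').antisymm (hcontains' G hG hGn hGc.groupTypeSet)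
  · rintro G ⟨hG, hGn, hGg, hcontains⟩ Q iQ f ⟨hmul, hsurj, hfib⟩ D hD hDn hDg
    have hf : ∀ x y, f (x * y) = f x * f y := fun x y => hmul x trivial y trivial
    have : Finite Q := Finite.of_surjective f fun q => by
      obtain ⟨x, -, hx⟩ := hsurj q
      exact ⟨x, hx⟩
    have hker : ∀ x, f x = 1 ↔ x ∈ G := fun x => by
      rw [← map_one_of_map_mul hf, hfib x trivial 1 trivial]
      simp [Set.singleton_mul, MoufangLoop.one_mul]
    have hpre : f ⁻¹' {1} = G := Set.ext hker
    have hchain := (hDg.assocChain hD).preimage hf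
    rw [hpre] at hchain
    have hle : f ⁻¹' D ⊆ G := hcontains _ (hD.preimage hf)
      (hDn.preimage hf isSubloopSet_univ hD) ((hGg.assocChain hG).trans hchain).groupTypeSet
    refine Set.Subset.antisymm (fun d hd => ?_) (Set.singleton_subset_iff.2 hD.1)
    obtain ⟨x, -, rfl⟩ := hsurj d
    exact (hker x).2 (hle hd)
end

section
/- Let M be a finite Moufang loop and let N be a minimal normal subloop of M. Then N is the direct product of pairwise isomorphic simple loops. Furthermore, if N is nonassociative, then N is itself simple. -/
open Pointwise

namespace MoufangLoop

/-- A simple loop: one with no nontrivial proper normal subloops. -/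
def IsSimpleLoop (L : Type*) [MoufangLoop L] : Prop :=
  ∀ D : Set L, IsSubloopSet D → IsNormalIn D Set.univ → D = ({1} : Set L) ∨ D = Set.univ

/-- The subloop `N` of `M` is (isomorphic to) the direct product of `k` copies of `L`. -/
def IsDirectPowerOf {M : Type*} [MoufangLoop M] (N : Set M) (k : ℕ) (L : Type*)
    [MoufangLoop L] : Prop :=
  ∃ f : (Fin k → L) → M, Function.Injective f ∧ Set.range f = N ∧
    ∀ u v : Fin k → L, f (u * v) = f u * f v

end MoufangLoop

namespace MoufangLoop

section Basic

variable {M : Type*} [MoufangLoop M]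

theorem mul_left_cancel' {a b c : M} (h : a * b = a * c) : b = c :=
  (existsUnique_mul_left a (a * c)).unique h rfl

theorem mul_right_cancel' {a b c : M} (h : b * a = c * a) : b = c :=
  (existsUnique_mul_right a (c * a)).unique h rfl

theorem flexible (x z : M) : x * (z * x) = (x * z) * x := by
  have h := moufang x 1 z
  rwa [mul_one, one_mul] at h

/-- The inverse of an element of a Moufang loop. -/
noncomputable def inv (x : M) : M := lsol x 1

theorem mul_inv (x : M) : x * inv x = 1 := mul_lsol x 1

theorem mul_inv_mul (x z : M) : x * (inv x * z) = z := by
  have h := moufang x (inv x) z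
  rw [mul_inv, one_mul] at h
  exact (mul_right_cancel' h).symm

theorem inv_mul (x : M) : inv x * x = 1 :=
  mul_left_cancel' (a := x) (by rw [mul_inv_mul, mul_one])

theorem inv_inv (x : M) : inv (inv x) = x :=
  mul_left_cancel' (a := inv x) (by rw [mul_inv, inv_mul])

theorem inv_mul_mul (x z : M) : inv x * (x * z) = z := by
  have h := mul_inv_mul (inv x) z
  rwa [inv_inv] at h

theorem mul_inv_mul_right (x y : M) : (y * inv x) * x = y := by
  have h := moufang x y (inv x)
  rw [inv_mul, mul_one, ← flexible] at h
  exact (mul_left_cancel' h).symm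

theorem mul_mul_inv (x y : M) : (y * x) * inv x = y := by
  have h := mul_inv_mul_right (inv x) y
  rwa [inv_inv] at h

theorem inv_one : inv (1 : M) = 1 := by
  have h := mul_inv (1 : M)
  rwa [one_mul] at h

theorem inv_mul_rev (x y : M) : inv (x * y) = inv y * inv x := by
  have h : inv (x * y) * x = inv y := by
    have h2 := inv_mul_mul (x * y) (inv y)
    rwa [mul_mul_inv] at h2
  rw [← h, mul_mul_inv]

theorem lsol_eq (a b : M) : lsol a b = inv a * b :=
  mul_left_cancel' (a := a) (by rw [mul_lsol, mul_inv_mul])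

theorem rsol_eq (a b : M) : rsol a b = b * inv a :=
  mul_right_cancel' (a := a) (by rw [rsol_mul, mul_inv_mul_right])

theorem IsSubloopSet.inv_mem {A : Set M} (hA : IsSubloopSet A) {x : M} (hx : x ∈ A) :
    inv x ∈ A :=
  hA.2.2.1 x hx 1 hA.1

/-- The left coset map of a normal subloop is compatible with the multiplication. -/
theorem IsNormalIn.singleton_mul {A D : Set M} (hDA : IsNormalIn D A) (hA : IsSubloopSet A)
    {x y : M} (hx : x ∈ A) (hy : y ∈ A) :
    ({x * y} : Set M) * D = {x} * (({y} : Set M) * D) ∧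
      ({x * y} : Set M) * D = ({x} : Set M) * D * {y} := by
  obtain ⟨-, h1, h2, h3⟩ := hDA
  have h4 := h1 (x * y) (hA.2.1 x hx y hy)
  have h5 : ({x * y} : Set M) * D = ({x} : Set M) * D * {y} := by
    rw [← h4, h2 x hx y hy, h1 x hx]
  exact ⟨by rw [h5, h3 x hx y hy, h1 y hy], h5⟩

theorem IsSubloopSet.singleton_mul {D : Set M} (hD : IsSubloopSet D) {x : M} :
    ({x} : Set M) * D = {1} * D ↔ x ∈ D := by
  constructor
  · intro h
    have : x ∈ ({x} : Set M) * D := ⟨x, rfl, 1, hD.1, mul_one x⟩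
    rw [h] at this
    obtain ⟨_, rfl, d, hd, rfl⟩ := this
    simpa only [one_mul] using hd
  · intro hx
    ext z
    simp only [Set.singleton_mul, Set.mem_image, one_mul, exists_eq_right]
    constructor
    · rintro ⟨d, hd, rfl⟩
      exact hD.2.1 x hx d hd
    · intro hz
      exact ⟨inv x * z, hD.2.1 _ (hD.inv_mem hx) _ hz, mul_inv_mul x z⟩

/-- The congruence whose class of `1` is a given normal subloop. -/
theorem exists_con {N : Set M} (hN : IsSubloopSet N) (hNn : IsNormalIn N Set.univ) :
    ∃ c : Con M, ∀ x, c x 1 ↔ x ∈ N := by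
  have hU : IsSubloopSet (Set.univ : Set M) := by simp [IsSubloopSet]
  refine ⟨⟨⟨fun x y => ({x} : Set M) * N = {y} * N, fun _ => rfl, fun h => h.symm,
    fun h h' => h.trans h'⟩, ?_⟩, fun x => hN.singleton_mul⟩
  intro w x y z h1 h2
  change ({w} : Set M) * N = {x} * N at h1
  change ({y} : Set M) * N = {z} * N at h2
  change ({w * y} : Set M) * N = {x * z} * N
  rw [(hNn.singleton_mul hU (Set.mem_univ w) (Set.mem_univ y)).2, h1,
    ← (hNn.singleton_mul hU (Set.mem_univ x) (Set.mem_univ y)).2,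
    (hNn.singleton_mul hU (Set.mem_univ x) (Set.mem_univ y)).1, h2,
    ← (hNn.singleton_mul hU (Set.mem_univ x) (Set.mem_univ z)).1]

theorem con_mul_left_iff (c : Con M) (x y z : M) : c (x * y) (x * z) ↔ c y z :=
  ⟨fun h => by simpa only [inv_mul_mul] using c.mul (c.refl (inv x)) h,
    fun h => c.mul (c.refl x) h⟩

theorem con_mul_right_iff (c : Con M) (x y z : M) : c (y * x) (z * x) ↔ c y z :=
  ⟨fun h => by simpa only [mul_mul_inv] using c.mul h (c.refl (inv x)),
    fun h => c.mul h (c.refl x)⟩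

theorem con_inv (c : Con M) {x y : M} (h : c x y) : c (inv x) (inv y) := by
  rw [← con_mul_left_iff c x, ← con_mul_right_iff c y, mul_inv, one_mul, mul_inv_mul_right]
  exact c.symm h

/-- The class of `1` of a congruence is a normal subloop. -/
theorem isSubloopSet_con (c : Con M) : IsSubloopSet {x | c x 1} := by
  refine ⟨c.refl 1, ?_, ?_, ?_⟩
  · intro x hx y hy
    simpa only [mul_one, Set.mem_ofPred_eq] using c.mul hx hy
  · intro x hx y hy
    simpa only [lsol_eq, Set.mem_ofPred_eq, mul_one, inv_one] using c.mul (con_inv c hx) hy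
  · intro x hx y hy
    simpa only [rsol_eq, Set.mem_ofPred_eq, mul_one, inv_one] using c.mul hy (con_inv c hx)

theorem isNormalIn_con (c : Con M) : IsNormalIn {x | c x 1} Set.univ := by
  have hl : ∀ x, ({x} : Set M) * {x | c x 1} = {z | c z x} := by
    intro x
    ext z
    simp only [Set.singleton_mul, Set.mem_image, Set.mem_ofPred_eq]
    constructor
    · rintro ⟨d, hd, rfl⟩
      simpa only [mul_one] using c.mul (c.refl x) hd
    · intro h
      exact ⟨inv x * z, by simpa only [inv_mul] using c.mul (c.refl (inv x)) h, mul_inv_mul x z⟩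
  have hr : ∀ x, {x | c x 1} * ({x} : Set M) = {z | c z x} := by
    intro x
    ext z
    simp only [Set.mul_singleton, Set.mem_image, Set.mem_ofPred_eq]
    constructor
    · rintro ⟨d, hd, rfl⟩
      simpa only [one_mul] using c.mul hd (c.refl x)
    · intro h
      exact ⟨z * inv x, by simpa only [mul_inv] using c.mul h (c.refl (inv x)),
        mul_inv_mul_right x z⟩
  have hr' : ∀ x y, {z | c z x} * ({y} : Set M) = {z | c z (x * y)} := by
    intro x y
    ext z
    simp only [Set.mul_singleton, Set.mem_image, Set.mem_ofPred_eq]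
    constructor
    · rintro ⟨d, hd, rfl⟩
      exact c.mul hd (c.refl y)
    · intro h
      exact ⟨z * inv y, by simpa only [mul_mul_inv] using c.mul h (c.refl (inv y)),
        mul_inv_mul_right y z⟩
  have hl' : ∀ x y, ({x} : Set M) * {z | c z y} = {z | c z (x * y)} := by
    intro x y
    ext z
    simp only [Set.singleton_mul, Set.mem_image, Set.mem_ofPred_eq]
    constructor
    · rintro ⟨d, hd, rfl⟩
      exact c.mul (c.refl x) hd
    · intro h
      exact ⟨inv x * z, by simpa only [inv_mul_mul] using c.mul (c.refl (inv x)) h,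
        mul_inv_mul x z⟩
  refine ⟨Set.subset_univ _, fun x _ => by rw [hl, hr], fun x _ y _ => by rw [hr, hr, hr'],
    fun x _ y _ => by rw [hl, hr, hl', hr']⟩

end Basic

end MoufangLoop

section GroupTheory

variable {G : Type*} [Group G]

/-- A subgroup which is a nonabelian simple group. -/
structure IsNonabelianSimple (V : Subgroup G) : Prop where
  simple : ∀ Y ≤ V, (∀ v ∈ V, ∀ y ∈ Y, v * y * v⁻¹ ∈ Y) → Y = ⊥ ∨ Y = V
  nonabelian : ¬ ∀ u ∈ V, ∀ v ∈ V, u * v = v * u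

theorem IsNonabelianSimple.eq_one {V : Subgroup G} (hV : IsNonabelianSimple V) {z : G}
    (hz : z ∈ V) (h : ∀ v ∈ V, v * z = z * v) : z = 1 := by
  have hY : ∀ y ∈ V ⊓ Subgroup.centralizer V, ∀ v ∈ V, v * y = y * v := fun y hy v hv =>
    Subgroup.mem_centralizer_iff.1 hy.2 v hv
  rcases hV.simple (V ⊓ Subgroup.centralizer V) inf_le_left (fun v hv y hy => by
    rw [hY y hy v hv, mul_inv_cancel_right]; exact hy) with h1 | h1
  · have : z ∈ V ⊓ Subgroup.centralizer (V : Set G) :=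
      ⟨hz, Subgroup.mem_centralizer_iff.2 h⟩
    rwa [h1, Subgroup.mem_bot] at this
  · refine absurd (fun u hu v hv => hY v ?_ u hu) hV.nonabelian
    rwa [h1]

/-- A nonabelian simple group has no automorphism `ρ` with `k * ρ k * ρ² k = 1` for all `k`. -/
theorem IsNonabelianSimple.not_splitting {V : Subgroup G} (hV : IsNonabelianSimple V)
    (ρ : MulAut G) (hρ : ∀ k ∈ V, ρ k ∈ V) (h : ∀ k ∈ V, k * ρ k * ρ (ρ k) = 1) : False := by
  have hcomm : ∀ g ∈ V, ∀ k ∈ V, k * (g * ρ k * g⁻¹) = (g * ρ k * g⁻¹) * k := by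
    intro g hg k hk
    have key : ∀ k ∈ V, k * (g * ρ k * g⁻¹) * (g * ρ g * ρ (ρ k) * (ρ g)⁻¹ * g⁻¹) = 1 := by
      intro k hk
      have h1 := h (k * g) (V.mul_mem hk hg)
      have h2 : ρ (ρ g) = (ρ g)⁻¹ * g⁻¹ := by
        rw [← mul_inv_rev]; exact eq_inv_of_mul_eq_one_right (h g hg)
      simp only [map_mul, h2] at h1
      rw [← h1]
      group
    have h3 := key k hk
    have h4 := key k⁻¹ (V.inv_mem hk)
    simp only [map_inv] at h4
    set a := g * ρ k * g⁻¹ with ha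
    set b := g * ρ g * ρ (ρ k) * (ρ g)⁻¹ * g⁻¹ with hb
    have h5 : k⁻¹ * a⁻¹ * b⁻¹ = 1 := by
      rw [← h4, ha, hb]; group
    have h6 : b = (k * a)⁻¹ := eq_inv_of_mul_eq_one_right h3
    have h7 : b = k⁻¹ * a⁻¹ := (mul_inv_eq_one.1 h5).symm
    have h8 : a * k = k * a := by
      rw [← inv_inj, ← h6, h7, mul_inv_rev]
    exact h8.symm
  apply hV.nonabelian
  intro u hu v hv
  let Z : Subgroup G :=
    V ⊓ Subgroup.centralizer {x | ∃ g ∈ V, x = g * ρ u * g⁻¹}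
  have hZ : ∀ y, y ∈ Z ↔ y ∈ V ∧ ∀ g ∈ V, (g * ρ u * g⁻¹) * y = y * (g * ρ u * g⁻¹) := by
    intro y
    simp only [Z, Subgroup.mem_inf, Subgroup.mem_centralizer_iff, Set.mem_ofPred_eq]
    constructor
    · rintro ⟨h1, h2⟩
      exact ⟨h1, fun g hg => h2 _ ⟨g, hg, rfl⟩⟩
    · rintro ⟨h1, h2⟩
      refine ⟨h1, ?_⟩
      rintro _ ⟨g, hg, rfl⟩
      exact h2 g hg
  have huZ : u ∈ Z := (hZ u).2 ⟨hu, fun g hg => (hcomm g hg u hu).symm⟩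
  rcases hV.simple Z inf_le_left (fun v hv y hy => by
    obtain ⟨h1, h2⟩ := (hZ y).1 hy
    refine (hZ _).2 ⟨V.mul_mem (V.mul_mem hv h1) (V.inv_mem hv), fun g hg => ?_⟩
    have h3 := h2 (v⁻¹ * g) (V.mul_mem (V.inv_mem hv) hg)
    have h4 : v * (v⁻¹ * g * ρ u * (v⁻¹ * g)⁻¹ * y) * v⁻¹
      = v * (y * (v⁻¹ * g * ρ u * (v⁻¹ * g)⁻¹)) * v⁻¹ := by rw [h3]
    calc _ = v * (v⁻¹ * g * ρ u * (v⁻¹ * g)⁻¹ * y) * v⁻¹ := by group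
      _ = _ := h4
      _ = _ := by group) with h1 | h1
  · rw [h1, Subgroup.mem_bot] at huZ
    rw [huZ, one_mul, mul_one]
  · have h2 : ρ u = 1 := hV.eq_one (hρ u hu) (fun v hv => by
      rw [← h1] at hv
      simpa using (((hZ v).1 hv).2 1 V.one_mem).symm)
    have h3 : u = 1 := by simpa using h2
    rw [h3, one_mul, mul_one]

section Triality

variable {𝒯 : Set (Subgroup G)} {t ρ : MulAut G}

/-- Some reflection fixes a given nonabelian simple factor of a group with triality. -/
theorem reflection_smul_eq
    (hcomm : ∀ U ∈ 𝒯, ∀ V ∈ 𝒯, U ≠ V → ∀ u ∈ U, ∀ v ∈ V, u * v = v * u)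
    (hsimple : ∀ U ∈ 𝒯, IsNonabelianSimple U)
    (ht : ∀ U ∈ 𝒯, t • U ∈ 𝒯) (hρ : ∀ U ∈ 𝒯, ρ • U ∈ 𝒯)
    (hρ3 : ρ * ρ * ρ = 1)
    (htri : ∀ U ∈ 𝒯, ∀ k ∈ U, (t k * k⁻¹) * ρ (t k * k⁻¹) * ρ (ρ (t k * k⁻¹)) = 1)
    {V : Subgroup G} (hV : V ∈ 𝒯) :
    t • V = V ∨ ρ • t • V = V ∨ ρ • ρ • t • V = V := by
  by_contra! hne
  obtain ⟨h1, h2, h3⟩ := hne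
  have hs := hsimple V hV
  have c1 : ∀ k ∈ V, ∀ v ∈ V, t k * v = v * t k := fun k hk v hv =>
    hcomm _ (ht V hV) V hV h1 _ (Subgroup.smul_mem_pointwise_smul k t V hk) v hv
  have c2 : ∀ k ∈ V, ∀ v ∈ V, ρ (t k) * v = v * ρ (t k) := fun k hk v hv =>
    hcomm _ (hρ _ (ht V hV)) V hV h2 _ (Subgroup.smul_mem_pointwise_smul _ ρ _
      (Subgroup.smul_mem_pointwise_smul k t V hk)) v hv
  have c3 : ∀ k ∈ V, ∀ v ∈ V, ρ (ρ (t k)) * v = v * ρ (ρ (t k)) := fun k hk v hv =>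
    hcomm _ (hρ _ (hρ _ (ht V hV))) V hV h3 _ (Subgroup.smul_mem_pointwise_smul _ ρ _
      (Subgroup.smul_mem_pointwise_smul _ ρ _
      (Subgroup.smul_mem_pointwise_smul k t V hk))) v hv
  by_cases hρV : ρ • V = V
  · have hm : ∀ k ∈ V, ρ k ∈ V := fun k hk => by
      have := Subgroup.smul_mem_pointwise_smul k ρ V hk
      rwa [hρV] at this
    refine hs.not_splitting ρ hm fun k hk => ?_
    have hk' := V.inv_mem hk
    have h4 := htri V hV k⁻¹ hk'
    simp only [inv_inv, map_mul] at h4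
    have e1 : t k⁻¹ * k * (ρ (t k⁻¹) * ρ k) * (ρ (ρ (t k⁻¹)) * ρ (ρ k))
        = t k⁻¹ * (k * ρ (t k⁻¹)) * (ρ k * ρ (ρ (t k⁻¹))) * ρ (ρ k) := by group
    rw [e1, ← c2 _ hk' _ hk, ← c3 _ hk' _ (hm _ hk)] at h4
    have e2 : t k⁻¹ * (ρ (t k⁻¹) * k) * (ρ (ρ (t k⁻¹)) * ρ k) * ρ (ρ k)
        = t k⁻¹ * ρ (t k⁻¹) * (k * ρ (ρ (t k⁻¹))) * ρ k * ρ (ρ k) := by group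
    rw [e2, ← c3 _ hk' _ hk] at h4
    have h5 : k * ρ k * ρ (ρ k) = (t k⁻¹ * ρ (t k⁻¹) * ρ (ρ (t k⁻¹)))⁻¹ := by
      apply eq_inv_of_mul_eq_one_right
      rw [← h4]; group
    refine hs.eq_one (V.mul_mem (V.mul_mem hk (hm _ hk)) (hm _ (hm _ hk))) fun v hv => ?_
    rw [h5]
    refine (Commute.inv_right (Commute.mul_right (Commute.mul_right ?_ ?_) ?_)).eq
    · exact (c1 _ hk' v hv).symm
    · exact (c2 _ hk' v hv).symm
    · exact (c3 _ hk' v hv).symm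
  · have hρρV : ρ • ρ • V ≠ V := fun h => hρV (by
      have h5 : (ρ * ρ * ρ) • V = V := by rw [hρ3, one_smul]
      rwa [mul_assoc, mul_smul, mul_smul, h] at h5)
    apply hs.nonabelian
    intro u hu k hk
    have c4 : ρ k * u = u * ρ k :=
      hcomm _ (hρ V hV) V hV hρV _ (Subgroup.smul_mem_pointwise_smul _ ρ _ hk) u hu
    have c5 : ρ (ρ k) * u = u * ρ (ρ k) :=
      hcomm _ (hρ _ (hρ V hV)) V hV hρρV _ (Subgroup.smul_mem_pointwise_smul _ ρ _
        (Subgroup.smul_mem_pointwise_smul _ ρ _ hk)) u hu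
    have h4 := htri V hV k hk
    simp only [map_mul, map_inv] at h4
    have h5 : k = (ρ (t k) * (ρ k)⁻¹) * (ρ (ρ (t k)) * (ρ (ρ k))⁻¹) * t k := by
      have h6 : k⁻¹ * ((ρ (t k) * (ρ k)⁻¹) * (ρ (ρ (t k)) * (ρ (ρ k))⁻¹)) = (t k)⁻¹ :=
        eq_inv_of_mul_eq_one_right (by rw [← h4]; group)
      rw [inv_mul_eq_iff_eq_mul] at h6
      rw [h6, inv_mul_cancel_right]
    rw [h5]
    have d1 : Commute u (t k) := (c1 k hk u hu).symm
    have d2 : Commute u (ρ (t k)) := (c2 k hk u hu).symm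
    have d3 : Commute u (ρ (ρ (t k))) := (c3 k hk u hu).symm
    have d4 : Commute u (ρ k) := c4.symm
    have d5 : Commute u (ρ (ρ k)) := c5.symm
    exact (((d2.mul_right d4.inv_right).mul_right (d3.mul_right d5.inv_right)).mul_right d1).eq

/-- A reflection normalizing, but not `ρ`, a nonabelian simple factor centralizes it. -/
theorem reflection_apply_eq
    (hcomm : ∀ U ∈ 𝒯, ∀ V ∈ 𝒯, U ≠ V → ∀ u ∈ U, ∀ v ∈ V, u * v = v * u)
    (hsimple : ∀ U ∈ 𝒯, IsNonabelianSimple U)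
    (hρ : ∀ U ∈ 𝒯, ρ • U ∈ 𝒯) (hρ3 : ρ * ρ * ρ = 1)
    (htri : ∀ U ∈ 𝒯, ∀ k ∈ U, (t k * k⁻¹) * ρ (t k * k⁻¹) * ρ (ρ (t k * k⁻¹)) = 1)
    {V : Subgroup G} (hV : V ∈ 𝒯) (htV : t • V = V) (hρV : ρ • V ≠ V)
    {k : G} (hk : k ∈ V) : t k = k := by
  have hρρV : ρ • ρ • V ≠ V := fun h => hρV (by
    have h5 : (ρ * ρ * ρ) • V = V := by rw [hρ3, one_smul]
    rwa [mul_assoc, mul_smul, mul_smul, h] at h5)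
  have hs := hsimple V hV
  have hw : t k * k⁻¹ ∈ V := by
    refine V.mul_mem ?_ (V.inv_mem hk)
    have := Subgroup.smul_mem_pointwise_smul k t V hk
    rwa [htV] at this
  refine mul_inv_eq_one.1 (hs.eq_one hw fun u hu => ?_)
  have c4 : Commute u (ρ (t k * k⁻¹)) :=
    (hcomm _ (hρ V hV) V hV hρV _ (Subgroup.smul_mem_pointwise_smul _ ρ _ hw) u hu).symm
  have c5 : Commute u (ρ (ρ (t k * k⁻¹))) :=
    (hcomm _ (hρ _ (hρ V hV)) V hV hρρV _ (Subgroup.smul_mem_pointwise_smul _ ρ _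
      (Subgroup.smul_mem_pointwise_smul _ ρ _ hw)) u hu).symm
  have h4 := htri V hV k hk
  rw [mul_assoc] at h4
  rw [eq_inv_of_mul_eq_one_left h4]
  exact (c4.mul_right c5).inv_right.eq

/-- A nonabelian simple factor of a group with triality is either normalized by all of the
symmetric group or centralized by a reflection. -/
theorem smul_eq_or_reflection_apply_eq
    (hcomm : ∀ U ∈ 𝒯, ∀ V ∈ 𝒯, U ≠ V → ∀ u ∈ U, ∀ v ∈ V, u * v = v * u)
    (hsimple : ∀ U ∈ 𝒯, IsNonabelianSimple U)
    (ht : ∀ U ∈ 𝒯, t • U ∈ 𝒯) (hρ : ∀ U ∈ 𝒯, ρ • U ∈ 𝒯)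
    (hρ3 : ρ * ρ * ρ = 1) (htρ : t * ρ = ρ⁻¹ * t)
    (htri : ∀ U ∈ 𝒯, ∀ k ∈ U, (t k * k⁻¹) * ρ (t k * k⁻¹) * ρ (ρ (t k * k⁻¹)) = 1)
    {V : Subgroup G} (hV : V ∈ 𝒯) :
    (t • V = V ∧ ρ • V = V) ∨ (∀ k ∈ V, t k = k) ∨ (∀ k ∈ V, ρ (t k) = k) ∨
      (∀ k ∈ V, ρ (ρ (t k)) = k) := by
  have hρ3' : ∀ k, ρ (ρ (ρ k)) = k := fun k => by
    have := congrArg (fun f : MulAut G => f k) hρ3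
    simpa using this
  have hρ3V : ∀ V : Subgroup G, ρ • ρ • ρ • V = V := fun V => by
    rw [← mul_smul, ← mul_smul, hρ3, one_smul]
  have hρtρ : ∀ k, ρ (t (ρ k)) = t k := fun k => by
    have := congrArg (fun f : MulAut G => ρ (f k)) htρ
    simpa using this
  have hρtρV : ∀ V : Subgroup G, ρ • t • ρ • V = t • V := fun V => by
    rw [← mul_smul t, htρ, mul_smul, smul_inv_smul]
  by_cases hρV : ρ • V = V
  · left
    refine ⟨?_, hρV⟩
    have h1 : ρ • t • V = t • V := by
      have := hρtρV V
      rwa [hρV] at this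
    rcases reflection_smul_eq hcomm hsimple ht hρ hρ3 htri hV with h | h | h
    · exact h
    · rwa [h1] at h
    · rwa [h1, h1] at h
  right
  rcases reflection_smul_eq hcomm hsimple ht hρ hρ3 htri hV with h | h | h
  · exact Or.inl fun k hk => reflection_apply_eq hcomm hsimple hρ hρ3 htri hV h hρV hk
  · refine Or.inr (Or.inl fun k hk => ?_)
    have h1 : t • ρ • V = ρ • V := by
      rw [← hρ3V (t • ρ • V), hρtρV, h]
    have h2 := reflection_apply_eq hcomm hsimple hρ hρ3 htri (hρ V hV) h1
      (fun h' => hρV (smul_left_cancel ρ h')) (Subgroup.smul_mem_pointwise_smul k ρ V hk)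
    change t (ρ k) = ρ k at h2
    rw [← hρtρ k, h2, hρ3']
  · refine Or.inr (Or.inr fun k hk => ?_)
    have h0 : t • V = ρ • V := by rw [← hρ3V (t • V), h]
    have h1 : t • ρ • ρ • V = ρ • ρ • V := by
      rw [← hρ3V (t • ρ • ρ • V), hρtρV, hρtρV, h0]
    have h2 := reflection_apply_eq hcomm hsimple hρ hρ3 htri (hρ _ (hρ V hV)) h1
      (fun h' => hρV (smul_left_cancel ρ (smul_left_cancel ρ h')))
      (Subgroup.smul_mem_pointwise_smul _ ρ _ (Subgroup.smul_mem_pointwise_smul k ρ V hk))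
    change t (ρ (ρ k)) = ρ (ρ k) at h2
    rw [← hρtρ k, ← hρtρ (ρ k), h2, hρ3', hρ3']

end Triality

end GroupTheory

section Decomposition

variable {G : Type*} [Group G]

/-- `U` is a minimal normal subgroup of `K`. -/
structure IsMinNormal (K U : Subgroup G) : Prop where
  ne_bot : U ≠ ⊥
  le : U ≤ K
  normal : ∀ k ∈ K, ∀ u ∈ U, k * u * k⁻¹ ∈ U
  minimal : ∀ Y ≤ U, (∀ k ∈ K, ∀ y ∈ Y, k * y * k⁻¹ ∈ Y) → Y = ⊥ ∨ Y = U

theorem exists_isMinNormal [Finite G] {K : Subgroup G} (hK : K ≠ ⊥) : ∃ U, IsMinNormal K U := by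
  obtain ⟨U, ⟨h1, h2, h3⟩, h4⟩ := (wellFounded_lt (α := Subgroup G)).has_min
    {U | U ≠ ⊥ ∧ U ≤ K ∧ ∀ k ∈ K, ∀ u ∈ U, k * u * k⁻¹ ∈ U}
    ⟨K, hK, le_rfl, fun k hk u hu => K.mul_mem (K.mul_mem hk hu) (K.inv_mem hk)⟩
  refine ⟨U, h1, h2, h3, fun Y hY hn => ?_⟩
  by_contra! h
  exact h4 Y ⟨h.1, hY.trans h2, hn⟩ (lt_of_le_of_ne hY h.2)

theorem IsMinNormal.smul {K U : Subgroup G} (hU : IsMinNormal K U) {a : MulAut G}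
    (ha : a • K = K) : IsMinNormal K (a • U) := by
  have hK : ∀ k ∈ K, a⁻¹ • k ∈ K := fun k hk => by
    rwa [← Subgroup.mem_pointwise_smul_iff_inv_smul_mem, ha]
  have hK' : ∀ k ∈ K, a • k ∈ K := fun k hk => by
    have := Subgroup.smul_mem_pointwise_smul k a K hk
    rwa [ha] at this
  refine ⟨fun h => hU.ne_bot ?_, ?_, ?_, ?_⟩
  · rwa [← smul_left_cancel_iff a, Subgroup.smul_bot]
  · rw [← ha]
    exact Subgroup.pointwise_smul_le_pointwise_smul_iff.2 hU.le
  · intro k hk u hu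
    rw [Subgroup.mem_pointwise_smul_iff_inv_smul_mem] at hu ⊢
    rw [smul_mul', smul_mul', smul_inv']
    exact hU.normal _ (hK k hk) _ hu
  · intro Y hY hn
    have h1 : a⁻¹ • Y ≤ U := by rwa [← Subgroup.subset_pointwise_smul_iff]
    rcases hU.minimal _ h1 (fun k hk y hy => by
      rw [Subgroup.mem_inv_pointwise_smul_iff] at hy ⊢
      rw [smul_mul', smul_mul', smul_inv']
      exact hn _ (hK' k hk) _ hy) with h | h
    · left
      rw [inv_smul_eq_iff, Subgroup.smul_bot] at h
      exact h
    · exact Or.inr (inv_smul_eq_iff.1 h)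

theorem IsMinNormal.commute {K U V : Subgroup G} (hU : IsMinNormal K U) (hV : IsMinNormal K V)
    (h : U ≠ V) : ∀ u ∈ U, ∀ v ∈ V, u * v = v * u := by
  have hn : ∀ k ∈ K, ∀ y ∈ U ⊓ V, k * y * k⁻¹ ∈ U ⊓ V := fun k hk y hy =>
    ⟨hU.normal k hk y hy.1, hV.normal k hk y hy.2⟩
  have hbot : U ⊓ V = ⊥ := by
    rcases hU.minimal _ inf_le_left hn with h1 | h1
    · exact h1
    · rcases hV.minimal _ inf_le_right hn with h2 | h2
      · exact h2
      · exact absurd (h1.symm.trans h2) h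
  intro u hu v hv
  have h1 : u * v * u⁻¹ * v⁻¹ ∈ U ⊓ V := by
    refine ⟨?_, V.mul_mem (hV.normal u (hU.le hu) v hv) (V.inv_mem hv)⟩
    have := U.mul_mem hu (hU.normal v (hV.le hv) _ (U.inv_mem hu))
    rwa [mul_assoc, mul_assoc, ← mul_assoc v]
  rw [hbot, Subgroup.mem_bot, mul_inv_eq_one, mul_inv_eq_iff_eq_mul] at h1
  exact h1

/-- A nonabelian finite group which is minimal among the nontrivial subgroups invariant under a
group of automorphisms is generated by commuting nonabelian simple groups, which are permuted
transitively by the automorphisms. -/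
theorem exists_nonabelianSimple_factors [Finite G] {A : Subgroup (MulAut G)} {K : Subgroup G}
    (hA : ∀ a ∈ A, a • K = K)
    (hmin : ∀ Y ≤ K, (∀ a ∈ A, a • Y = Y) → Y = ⊥ ∨ Y = K)
    (hK : ¬ ∀ k ∈ K, ∀ h ∈ K, k * h = h * k) :
    ∃ T : Subgroup G, ∀ 𝒯 : Set (Subgroup G), 𝒯 = {U | ∃ a ∈ A, U = a • T} →
      Subgroup.closure {x | ∃ U ∈ 𝒯, x ∈ U} = K ∧ (∀ U ∈ 𝒯, IsMinNormal K U) ∧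
      ∀ U ∈ 𝒯, IsNonabelianSimple U := by
  obtain ⟨T, hT⟩ := exists_isMinNormal (K := K) (by
    rintro rfl
    apply hK
    intro k hk h hh
    rw [Subgroup.mem_bot.1 hk, Subgroup.mem_bot.1 hh])
  refine ⟨T, ?_⟩
  rintro 𝒯 rfl
  have hTm : ∀ U ∈ {U | ∃ a ∈ A, U = a • T}, IsMinNormal K U := by
    rintro _ ⟨a, ha, rfl⟩
    exact hT.smul (hA a ha)
  have hcl : Subgroup.closure {x | ∃ U ∈ {U | ∃ a ∈ A, U = a • T}, x ∈ U} = K := by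
    have hle : Subgroup.closure {x | ∃ U ∈ {U | ∃ a ∈ A, U = a • T}, x ∈ U} ≤ K := by
      rw [Subgroup.closure_le]
      rintro x ⟨U, hU, hx⟩
      exact (hTm U hU).le hx
    have hle2 : ∀ a ∈ A, a • Subgroup.closure {x | ∃ U ∈ {U | ∃ a ∈ A, U = a • T}, x ∈ U} ≤
        Subgroup.closure {x | ∃ U ∈ {U | ∃ a ∈ A, U = a • T}, x ∈ U} := by
      intro a ha
      rw [Subgroup.smul_closure]
      apply Subgroup.closure_mono
      rintro _ ⟨x, ⟨_, ⟨b, hb, rfl⟩, hx⟩, rfl⟩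
      refine ⟨(a * b) • T, ⟨a * b, A.mul_mem ha hb, rfl⟩, ?_⟩
      rw [mul_smul]
      exact Subgroup.smul_mem_pointwise_smul x a _ hx
    rcases hmin _ hle (fun a ha => le_antisymm (hle2 a ha) (by
      rw [Subgroup.subset_pointwise_smul_iff]
      exact hle2 _ (A.inv_mem ha))) with h | h
    · refine absurd ?_ hT.ne_bot
      rw [eq_bot_iff, ← h]
      intro x hx
      exact Subgroup.subset_closure ⟨T, ⟨1, A.one_mem, (one_smul _ T).symm⟩, hx⟩
    · exact h
  refine ⟨hcl, hTm, fun U hU => ⟨fun Y hY hn => ?_, fun hab => hK ?_⟩⟩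
  · refine (hTm U hU).minimal Y hY fun k hk => ?_
    rw [← hcl] at hk
    suffices h : (∀ y ∈ Y, k * y * k⁻¹ ∈ Y) ∧ ∀ y ∈ Y, k⁻¹ * y * k ∈ Y from h.1
    induction hk using Subgroup.closure_induction with
    | mem x hx =>
      obtain ⟨V, hV, hx⟩ := hx
      by_cases h : U = V
      · subst h
        refine ⟨hn x hx, fun y hy => ?_⟩
        have := hn x⁻¹ (U.inv_mem hx) y hy
        rwa [inv_inv] at this
      · have hc := (hTm U hU).commute (hTm V hV) h
        refine ⟨fun y hy => ?_, fun y hy => ?_⟩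
        · rwa [← hc y (hY hy) x hx, mul_inv_cancel_right]
        · rwa [mul_assoc, hc y (hY hy) x hx, inv_mul_cancel_left]
    | one => simp
    | mul x y _ _ h1 h2 =>
      refine ⟨fun z hz => ?_, fun z hz => ?_⟩
      · have := h1.1 _ (h2.1 z hz)
        simpa only [mul_inv_rev, mul_assoc] using this
      · have := h2.2 _ (h1.2 z hz)
        simpa only [mul_inv_rev, mul_assoc] using this
    | inv x _ h => simpa only [inv_inv] using h.symm
  · have hTab : ∀ V ∈ {U | ∃ a ∈ A, U = a • T}, ∀ u ∈ V, ∀ v ∈ V, u * v = v * u := by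
      obtain ⟨b, hb, rfl⟩ := hU
      rintro _ ⟨a, ha, rfl⟩ u hu v hv
      rw [Subgroup.mem_pointwise_smul_iff_inv_smul_mem] at hu hv
      have := hab _ (Subgroup.smul_mem_pointwise_smul _ b T hu) _
        (Subgroup.smul_mem_pointwise_smul _ b T hv)
      rw [← smul_mul', ← smul_mul', ← smul_mul', ← smul_mul'] at this
      exact smul_left_cancel _ (smul_left_cancel _ this)
    have hle : K ≤ Subgroup.centralizer K := by
      have : K ≤ Subgroup.centralizer {x | ∃ U ∈ {U | ∃ a ∈ A, U = a • T}, x ∈ U} := by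
        conv_lhs => rw [← hcl]
        rw [Subgroup.closure_le]
        rintro x ⟨U, hU, hx⟩
        rw [SetLike.mem_coe, Subgroup.mem_centralizer_iff]
        rintro y ⟨V, hV, hy⟩
        by_cases h : V = U
        · subst h
          exact hTab V hV y hy x hx
        · exact (hTm V hV).commute (hTm U hU) h y hy x hx
      rwa [← Subgroup.centralizer_closure, hcl] at this
    intro k hk h hh
    exact Subgroup.mem_centralizer_iff.1 (hle hh) k hk

/-- An element of a direct product of nonabelian simple groups that lies in a normalized subgroup
meeting every factor trivially is trivial. -/
theorem eq_one_of_noncommPiCoprod_mem {ι : Type*} [Fintype ι] {H : ι → Subgroup G}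
    (hcomm : Pairwise fun i j => ∀ x y : G, x ∈ H i → y ∈ H j → Commute x y)
    (hs : ∀ i, IsNonabelianSimple (H i)) {Z : Subgroup G}
    (hZ : ∀ i, ∀ u ∈ H i, u ∈ Z → u = 1)
    (hn : ∀ i, ∀ u ∈ H i, ∀ z ∈ Z, u * z * u⁻¹ ∈ Z) {w : (i : ι) → H i}
    (hw : Subgroup.noncommPiCoprod hcomm w ∈ Z) : w = 1 := by
  classical
  funext i
  apply Subtype.ext
  refine (hs i).eq_one (w i).2 fun v hv => ?_
  have h1 : (Pi.mulSingle i ⟨v, hv⟩ : (i : ι) → H i) * w * (Pi.mulSingle i ⟨v, hv⟩)⁻¹ * w⁻¹ =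
      Pi.mulSingle i (⟨v, hv⟩ * w i * ⟨v, hv⟩⁻¹ * (w i)⁻¹) := by
    funext j
    by_cases h : j = i
    · subst h; simp
    · simp [Pi.mulSingle_eq_of_ne h]
  have h2 := congrArg (Subgroup.noncommPiCoprod hcomm) h1
  rw [Subgroup.noncommPiCoprod_mulSingle, map_mul, map_mul, map_mul, map_inv, map_inv,
    Subgroup.noncommPiCoprod_mulSingle] at h2
  have h3 := hZ i _ (SetLike.coe_mem _) (h2 ▸ Z.mul_mem (hn i v hv _ hw) (Z.inv_mem hw))
  simp only [Subgroup.coe_mul, Subgroup.coe_inv] at h3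
  rw [mul_inv_eq_one, mul_inv_eq_iff_eq_mul] at h3
  exact h3

end Decomposition

namespace MoufangLoop

section Autotopism

variable {M : Type*} [MoufangLoop M]

/-- Triples of permutations, among which the autotopisms live. -/
abbrev PermTriple (M : Type*) := Equiv.Perm M × Equiv.Perm M × Equiv.Perm M

/-- Inversion as a permutation. -/
noncomputable def invPerm (M : Type*) [MoufangLoop M] : Equiv.Perm M :=
  ⟨inv, inv, inv_inv, inv_inv⟩

/-- Left translation as a permutation. -/
noncomputable def mulLeftPerm (x : M) : Equiv.Perm M :=
  ⟨fun y => x * y, fun y => inv x * y, inv_mul_mul x, mul_inv_mul x⟩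

/-- Right translation as a permutation. -/
noncomputable def mulRightPerm (x : M) : Equiv.Perm M :=
  ⟨fun y => y * x, fun y => y * inv x, mul_mul_inv x, mul_inv_mul_right x⟩

@[simp] theorem invPerm_apply (x : M) : invPerm M x = inv x := rfl

@[simp] theorem mulLeftPerm_apply (x y : M) : mulLeftPerm x y = x * y := rfl

@[simp] theorem mulRightPerm_apply (x y : M) : mulRightPerm x y = y * x := rfl

@[simp] theorem mulLeftPerm_symm_apply (x y : M) :
    (mulLeftPerm x).symm y = inv x * y := rfl

@[simp] theorem mulRightPerm_symm_apply (x y : M) :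
    (mulRightPerm x).symm y = y * inv x := rfl

theorem invPerm_mul_self : invPerm M * invPerm M = 1 :=
  Equiv.ext fun x => by simp [inv_inv]

theorem invPerm_inv : (invPerm M)⁻¹ = invPerm M :=
  inv_eq_of_mul_eq_one_left invPerm_mul_self

/-- Conjugation by inversion. -/
noncomputable def invConj (M : Type*) [MoufangLoop M] : MulAut (Equiv.Perm M) :=
  MulAut.conj (invPerm M)

@[simp] theorem invConj_apply (α : Equiv.Perm M) (x : M) :
    invConj M α x = inv (α (inv x)) := by
  simp [invConj, invPerm_inv]

@[simp] theorem invConj_invConj (α : Equiv.Perm M) : invConj M (invConj M α) = α :=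
  Equiv.ext fun x => by simp [inv_inv]

/-- The automorphism `(α, β, γ) ↦ (γ, JβJ, α)` with `J` the inversion. -/
noncomputable def swapAut (M : Type*) [MoufangLoop M] : MulAut (PermTriple M) where
  toFun k := (k.2.2, invConj M k.2.1, k.1)
  invFun k := (k.2.2, invConj M k.2.1, k.1)
  left_inv k := by simp
  right_inv k := by simp
  map_mul' k l := by simp

/-- The automorphism `(α, β, γ) ↦ (JβJ, JαJ, JγJ)` with `J` the inversion. -/
noncomputable def oppAut (M : Type*) [MoufangLoop M] : MulAut (PermTriple M) where
  toFun k := (invConj M k.2.1, invConj M k.1, invConj M k.2.2)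
  invFun k := (invConj M k.2.1, invConj M k.1, invConj M k.2.2)
  left_inv k := by simp
  right_inv k := by simp
  map_mul' k l := by simp

/-- The automorphism of order three in the `S₃` of triality automorphisms. -/
noncomputable def rotAut (M : Type*) [MoufangLoop M] : MulAut (PermTriple M) :=
  swapAut M * oppAut M

@[simp] theorem swapAut_apply (k : PermTriple M) :
    swapAut M k = (k.2.2, invConj M k.2.1, k.1) := rfl

@[simp] theorem oppAut_apply (k : PermTriple M) :
    oppAut M k = (invConj M k.2.1, invConj M k.1, invConj M k.2.2) := rfl

@[simp] theorem rotAut_apply (k : PermTriple M) :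
    rotAut M k = (invConj M k.2.2, k.1, invConj M k.2.1) := by
  simp [rotAut]

theorem rotAut_pow_three : rotAut M * rotAut M * rotAut M = 1 :=
  MulEquiv.ext fun k => by simp

theorem oppAut_mul_self : oppAut M * oppAut M = 1 :=
  MulEquiv.ext fun k => by simp

theorem oppAut_mul_rotAut : oppAut M * rotAut M = (rotAut M)⁻¹ * oppAut M := by
  rw [eq_inv_mul_iff_mul_eq]
  exact MulEquiv.ext fun k => by simp

theorem rotAut_mul_oppAut : rotAut M * oppAut M = swapAut M := by
  rw [rotAut, mul_assoc, oppAut_mul_self, _root_.mul_one]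

/-- The autotopism of a Moufang loop given by the Moufang identity. -/
noncomputable def moufangTriple (x : M) : PermTriple M :=
  (mulLeftPerm x, mulRightPerm x, mulRightPerm x * mulLeftPerm x)

theorem mulLeftPerm_mul_mulRightPerm (x : M) :
    mulLeftPerm x * mulRightPerm x = mulRightPerm x * mulLeftPerm x :=
  Equiv.ext fun y => by simp [flexible]

theorem invConj_mulLeftPerm (x : M) : invConj M (mulLeftPerm x) = (mulRightPerm x)⁻¹ :=
  Equiv.ext fun y => by simp [inv_mul_rev, inv_inv]

theorem invConj_mulRightPerm (x : M) : invConj M (mulRightPerm x) = (mulLeftPerm x)⁻¹ :=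
  Equiv.ext fun y => by simp [inv_mul_rev, inv_inv]

theorem oppAut_moufangTriple (x : M) : oppAut M (moufangTriple x) = (moufangTriple x)⁻¹ := by
  simp [moufangTriple, invConj_mulLeftPerm, invConj_mulRightPerm, ← mul_inv_rev]

theorem rotAut_moufangTriple (x : M) : rotAut M (moufangTriple x) =
    ((mulRightPerm x * mulLeftPerm x)⁻¹, mulLeftPerm x, (mulLeftPerm x)⁻¹) := by
  simp [moufangTriple, invConj_mulLeftPerm, invConj_mulRightPerm, ← mul_inv_rev]

theorem rotAut_rotAut_moufangTriple (x : M) : rotAut M (rotAut M (moufangTriple x)) =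
    (mulRightPerm x, (mulRightPerm x * mulLeftPerm x)⁻¹, (mulRightPerm x)⁻¹) := by
  rw [rotAut_moufangTriple]
  simp [invConj_mulLeftPerm, map_inv]

theorem moufangTriple_mul_rotAut (x : M) : moufangTriple x * rotAut M (moufangTriple x) *
    rotAut M (rotAut M (moufangTriple x)) = 1 := by
  rw [rotAut_rotAut_moufangTriple, rotAut_moufangTriple, moufangTriple]
  simp [mul_assoc]

theorem commute_moufangTriple_rotAut (x : M) :
    Commute (moufangTriple x) (rotAut M (moufangTriple x)) := by
  rw [rotAut_moufangTriple, moufangTriple]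
  have h : Commute (mulLeftPerm x) (mulRightPerm x) := mulLeftPerm_mul_mulRightPerm x
  refine Prod.ext ?_ (Prod.ext ?_ ?_)
  · exact (h.mul_right (Commute.refl _)).inv_right
  · exact h.symm
  · exact (h.symm.mul_left (Commute.refl _)).inv_right

/-- The group of autotopisms. -/
def autotopisms (M : Type*) [MoufangLoop M] : Subgroup (PermTriple M) where
  carrier := {k | ∀ x y, k.1 x * k.2.1 y = k.2.2 (x * y)}
  one_mem' x y := rfl
  mul_mem' {k l} hk hl x y := by
    change k.1 (l.1 x) * k.2.1 (l.2.1 y) = k.2.2 (l.2.2 (x * y))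
    rw [hk, hl]
  inv_mem' {k} hk x y := by
    change k.1⁻¹ x * k.2.1⁻¹ y = k.2.2⁻¹ (x * y)
    rw [Equiv.Perm.eq_inv_iff_eq, ← hk]
    simp

theorem mem_autotopisms {k : PermTriple M} :
    k ∈ autotopisms M ↔ ∀ x y, k.1 x * k.2.1 y = k.2.2 (x * y) := Iff.rfl

theorem moufangTriple_mem (x : M) : moufangTriple x ∈ autotopisms M :=
  fun y z => moufang x y z

theorem swapAut_mem {k : PermTriple M} (hk : k ∈ autotopisms M) :
    swapAut M k ∈ autotopisms M := fun x y => by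
  have h := hk (x * y) (inv y)
  rw [mul_mul_inv] at h
  simp only [swapAut_apply, invConj_apply]
  rw [← h, mul_mul_inv]

theorem oppAut_mem {k : PermTriple M} (hk : k ∈ autotopisms M) :
    oppAut M k ∈ autotopisms M := fun x y => by
  simp only [oppAut_apply, invConj_apply]
  rw [← inv_mul_rev, hk, inv_mul_rev]

theorem ext_of_mem_autotopisms {k l : PermTriple M} (hk : k ∈ autotopisms M)
    (hl : l ∈ autotopisms M) (h1 : k.1 = l.1) (h2 : k.2.1 = l.2.1) : k = l := by
  refine Prod.ext h1 (Prod.ext h2 (Equiv.ext fun x => ?_))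
  have e := hk x 1
  rw [h1, h2, hl x 1, mul_one] at e
  exact e.symm

theorem oppAut_mul_inv {k : PermTriple M} (hk : k ∈ autotopisms M) :
    oppAut M k * k⁻¹ = moufangTriple (inv (k.2.2 1)) := by
  rw [mul_inv_eq_iff_eq_mul]
  refine ext_of_mem_autotopisms (oppAut_mem hk) (mul_mem (moufangTriple_mem _) hk) ?_ ?_
  · refine Equiv.ext fun x => ?_
    have h := hk x (inv x)
    rw [mul_inv] at h
    simp [moufangTriple, ← h, inv_mul_rev, mul_inv_mul_right]
  · refine Equiv.ext fun x => ?_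
    have h := hk (inv x) x
    rw [inv_mul] at h
    simp [moufangTriple, ← h, inv_mul_rev, mul_inv_mul]

theorem triality_of_mem_autotopisms {k : PermTriple M} (hk : k ∈ autotopisms M) :
    oppAut M k * k⁻¹ * rotAut M (oppAut M k * k⁻¹) *
      rotAut M (rotAut M (oppAut M k * k⁻¹)) = 1 := by
  rw [oppAut_mul_inv hk, moufangTriple_mul_rotAut]

theorem moufangTriple_injective : Function.Injective (moufangTriple : M → PermTriple M) := by
  intro x y h
  have h1 : (moufangTriple x).1 1 = (moufangTriple y).1 1 := by rw [h]
  simpa [moufangTriple, mul_one] using h1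

theorem moufangTriple_one : moufangTriple (1 : M) = 1 :=
  ext_of_mem_autotopisms (moufangTriple_mem 1) (one_mem _)
    (Equiv.ext fun x => one_mul x) (Equiv.ext fun x => mul_one x)

theorem moufangTriple_inv (x : M) : moufangTriple (inv x) = (moufangTriple x)⁻¹ :=
  ext_of_mem_autotopisms (moufangTriple_mem _) (inv_mem (moufangTriple_mem _))
    (Equiv.ext fun _ => rfl) (Equiv.ext fun _ => rfl)

/-- The group generated by the triality automorphisms and the conjugations by the
autotopisms `moufangTriple x`. -/
def trialityGroup (M : Type*) [MoufangLoop M] : Subgroup (MulAut (PermTriple M)) :=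
  Subgroup.closure ({swapAut M, oppAut M} ∪
    Set.range fun x : M => MulAut.conj (moufangTriple x))

theorem swapAut_mem_trialityGroup : swapAut M ∈ trialityGroup M :=
  Subgroup.subset_closure (Or.inl (Or.inl rfl))

theorem oppAut_mem_trialityGroup : oppAut M ∈ trialityGroup M :=
  Subgroup.subset_closure (Or.inl (Or.inr rfl))

theorem rotAut_mem_trialityGroup : rotAut M ∈ trialityGroup M :=
  mul_mem swapAut_mem_trialityGroup oppAut_mem_trialityGroup

theorem conj_mem_trialityGroup (x : M) :
    MulAut.conj (moufangTriple x) ∈ trialityGroup M :=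
  Subgroup.subset_closure (Or.inr ⟨x, rfl⟩)

theorem conj_rotAut_mem_trialityGroup {l : PermTriple M}
    (h : MulAut.conj l ∈ trialityGroup M) :
    MulAut.conj (rotAut M l) ∈ trialityGroup M := by
  have e : MulAut.conj (rotAut M l) = rotAut M * MulAut.conj l * (rotAut M)⁻¹ := by
    rw [eq_mul_inv_iff_mul_eq]
    exact MulEquiv.ext fun k => by
      simp only [MulAut.mul_apply, MulAut.conj_apply, map_mul, map_inv]
  rw [e]
  exact mul_mem (mul_mem rotAut_mem_trialityGroup h) (inv_mem rotAut_mem_trialityGroup)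

end Autotopism

end MoufangLoop

theorem Subgroup.smul_eq_of_forall_mem {G : Type*} [Group G] {A : Subgroup (MulAut G)}
    {Y : Subgroup G} (h : ∀ a ∈ A, ∀ y ∈ Y, a y ∈ Y) : ∀ a ∈ A, a • Y = Y := by
  have hle : ∀ a ∈ A, a • Y ≤ Y := by
    rintro a ha _ ⟨y, hy, rfl⟩
    exact h a ha y hy
  refine fun a ha => le_antisymm (hle a ha) ?_
  rw [Subgroup.subset_pointwise_smul_iff]
  exact hle _ (inv_mem ha)

theorem Subgroup.apply_mem_of_smul_eq {G : Type*} [Group G] {a : MulAut G}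
    {Y : Subgroup G} (h : a • Y = Y) {y : G} (hy : y ∈ Y) : a y ∈ Y := by
  rw [← h]
  exact Subgroup.smul_mem_pointwise_smul y a Y hy

namespace MoufangLoop

section Invariant

variable {M : Type*} [MoufangLoop M]

theorem smul_eq_of_mem_trialityGroup {Y : Subgroup (PermTriple M)}
    (hs : ∀ k ∈ Y, swapAut M k ∈ Y) (ht : ∀ k ∈ Y, oppAut M k ∈ Y)
    (hm : ∀ x, ∀ k ∈ Y, moufangTriple x * k * (moufangTriple x)⁻¹ ∈ Y) :
    ∀ a ∈ trialityGroup M, a • Y = Y := by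
  have key : ∀ a : MulAut (PermTriple M), (∀ k ∈ Y, a k ∈ Y) → (∀ k ∈ Y, a⁻¹ k ∈ Y) →
      a • Y = Y := by
    intro a h1 h2
    apply le_antisymm
    · rintro _ ⟨y, hy, rfl⟩
      exact h1 y hy
    · intro y hy
      rw [Subgroup.mem_pointwise_smul_iff_inv_smul_mem]
      exact h2 y hy
  have hle : trialityGroup M ≤ MulAction.stabilizer (MulAut (PermTriple M)) Y := by
    rw [trialityGroup, Subgroup.closure_le]
    rintro _ ((rfl | rfl) | ⟨x, rfl⟩)
    · exact key _ hs hs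
    · exact key _ ht ht
    · refine key _ (hm x) fun k hk => ?_
      rw [← map_inv, ← moufangTriple_inv]
      exact hm _ k hk
  exact fun a ha => hle ha

/-- `K` is minimal among the nontrivial subgroups of autotopisms invariant under the
triality group, it preserves the classes of the congruence `c`, and it acts transitively
on the class of `1`. -/
structure IsMinInvariant (c : Con M) (K : Subgroup (PermTriple M)) : Prop where
  ne_bot : K ≠ ⊥
  le_autotopisms : K ≤ autotopisms M
  smul_eq : ∀ a ∈ trialityGroup M, a • K = K
  minimal : ∀ Y ≤ K, (∀ a ∈ trialityGroup M, a • Y = Y) → Y = ⊥ ∨ Y = K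
  con_apply : ∀ k ∈ K, ∀ x, c (k.1 x) x
  exists_apply_one : ∀ x, c x 1 → ∃ k ∈ K, k.1 1 = x

/-- The autotopisms acting trivially modulo a congruence. -/
def conKer (c : Con M) : Subgroup (PermTriple M) where
  carrier := {k | k ∈ autotopisms M ∧ ∀ x, c (k.1 x) x ∧ c (k.2.1 x) x ∧ c (k.2.2 x) x}
  one_mem' := ⟨one_mem _, fun x => ⟨c.refl x, c.refl x, c.refl x⟩⟩
  mul_mem' {k l} hk hl := ⟨mul_mem hk.1 hl.1, fun x =>
    ⟨c.trans (hk.2 _).1 (hl.2 x).1, c.trans (hk.2 _).2.1 (hl.2 x).2.1,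
      c.trans (hk.2 _).2.2 (hl.2 x).2.2⟩⟩
  inv_mem' {k} hk := ⟨inv_mem hk.1, fun x => by
    refine ⟨?_, ?_, ?_⟩
    · simpa using c.symm (hk.2 (k.1⁻¹ x)).1
    · simpa using c.symm (hk.2 (k.2.1⁻¹ x)).2.1
    · simpa using c.symm (hk.2 (k.2.2⁻¹ x)).2.2⟩

theorem con_invConj {c : Con M} {α : Equiv.Perm M} (h : ∀ x, c (α x) x) (x : M) :
    c (invConj M α x) x := by
  simpa [inv_inv] using con_inv c (h (inv x))

theorem smul_conKer (c : Con M) : ∀ a ∈ trialityGroup M, a • conKer c = conKer c := by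
  have hL : ∀ (x : M) (α : Equiv.Perm M), (∀ y, c (α y) y) →
      ∀ y, c ((mulLeftPerm x * α * (mulLeftPerm x)⁻¹) y) y := by
    intro x α h y
    simpa [mul_inv_mul] using c.mul (c.refl x) (h (inv x * y))
  have hR : ∀ (x : M) (α : Equiv.Perm M), (∀ y, c (α y) y) →
      ∀ y, c ((mulRightPerm x * α * (mulRightPerm x)⁻¹) y) y := by
    intro x α h y
    simpa [mul_inv_mul_right] using c.mul (h (y * inv x)) (c.refl x)
  apply smul_eq_of_mem_trialityGroup
  · exact fun k hk => ⟨swapAut_mem hk.1, fun x =>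
      ⟨(hk.2 x).2.2, con_invConj (fun y => (hk.2 y).2.1) x, (hk.2 x).1⟩⟩
  · exact fun k hk => ⟨oppAut_mem hk.1, fun x => ⟨con_invConj (fun y => (hk.2 y).2.1) x,
      con_invConj (fun y => (hk.2 y).1) x, con_invConj (fun y => (hk.2 y).2.2) x⟩⟩
  · intro x k hk
    refine ⟨mul_mem (mul_mem (moufangTriple_mem x) hk.1) (inv_mem (moufangTriple_mem x)),
      fun y => ⟨hL x _ (fun z => (hk.2 z).1) y, hR x _ (fun z => (hk.2 z).2.1) y, ?_⟩⟩
    have h := hR x _ (hL x _ (fun z => (hk.2 z).2.2)) y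
    rw [← mul_assoc, ← mul_assoc, mul_assoc, ← mul_inv_rev] at h
    exact h

theorem moufangTriple_mem_conKer {c : Con M} {x : M} (hx : c x 1) :
    moufangTriple x ∈ conKer c := by
  have hL : ∀ y, c (x * y) y := fun y => by simpa [one_mul] using c.mul hx (c.refl y)
  have hR : ∀ y, c (y * x) y := fun y => by simpa [mul_one] using c.mul (c.refl y) hx
  exact ⟨moufangTriple_mem x, fun y => ⟨hL y, hR y, c.trans (hR _) (hL y)⟩⟩

/-- The congruence given by the orbits of the first components of a subgroup of
autotopisms invariant under the triality group. -/
def orbitCon (K : Subgroup (PermTriple M)) (hK : ∀ a ∈ trialityGroup M, a • K = K) :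
    Con M where
  r x y := ∃ k ∈ K, k.1 x = y
  iseqv := by
    refine ⟨fun x => ⟨1, one_mem _, rfl⟩, ?_, ?_⟩
    · rintro x _ ⟨k, hk, rfl⟩
      exact ⟨k⁻¹, inv_mem hk, by simp⟩
    · rintro x _ _ ⟨k, hk, rfl⟩ ⟨l, hl, rfl⟩
      exact ⟨l * k, mul_mem hl hk, rfl⟩
  mul' := by
    rintro w _ y _ ⟨k, hk, rfl⟩ ⟨l, hl, rfl⟩
    have h1 := Subgroup.apply_mem_of_smul_eq (hK _ (conj_mem_trialityGroup (k.1 w))) hl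
    have h2 := Subgroup.apply_mem_of_smul_eq (hK _ (conj_rotAut_mem_trialityGroup
      (conj_rotAut_mem_trialityGroup (conj_mem_trialityGroup y)))) hk
    rw [rotAut_rotAut_moufangTriple] at h2
    refine ⟨_, mul_mem h1 h2, ?_⟩
    simp [moufangTriple, mul_mul_inv, inv_mul_mul]

theorem exists_isMinInvariant [Finite M] (c : Con M) (hc : ∃ x, x ≠ 1 ∧ c x 1)
    (hmin : ∀ d : Con M, d ≤ c → (∀ x, d x 1 → x = 1) ∨ ∀ x, c x 1 → d x 1) :
    ∃ K, IsMinInvariant c K := by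
  have hne : conKer c ≠ ⊥ := by
    obtain ⟨x, hx, hcx⟩ := hc
    intro h
    have h1 := moufangTriple_mem_conKer hcx
    rw [h, Subgroup.mem_bot, ← moufangTriple_one] at h1
    exact hx (moufangTriple_injective h1)
  obtain ⟨K, ⟨h1, h2, h3⟩, h4⟩ := (wellFounded_lt (α := Subgroup (PermTriple M))).has_min
    {U | U ≠ ⊥ ∧ U ≤ conKer c ∧ ∀ a ∈ trialityGroup M, a • U = U}
    ⟨conKer c, hne, le_rfl, smul_conKer c⟩
  refine ⟨K, h1, fun k hk => (h2 hk).1, h3, fun Y hY hn => ?_,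
    fun k hk x => ((h2 hk).2 x).1, ?_⟩
  · by_contra! h
    exact h4 Y ⟨h.1, hY.trans h2, hn⟩ (lt_of_le_of_ne hY h.2)
  · rcases hmin (orbitCon K h3) (by
      rintro x _ ⟨k, hk, rfl⟩
      exact c.symm ((h2 hk).2 x).1) with h | h
    · refine absurd ((Subgroup.eq_bot_iff_forall K).2 fun k hk => ?_) h1
      have key : ∀ l ∈ K, l.1 = 1 := fun l hl => Equiv.ext fun x => by
        have e : orbitCon K h3 (l.1 x) x := (orbitCon K h3).symm ⟨l, hl, rfl⟩
        rw [← con_mul_left_iff _ (inv x), inv_mul] at e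
        have e' := h _ e
        rw [← inv_mul x] at e'
        exact mul_left_cancel' e'
      have k1 := key k hk
      have k3 := key _ (Subgroup.apply_mem_of_smul_eq (h3 _ swapAut_mem_trialityGroup) hk)
      have k2 := key _ (Subgroup.apply_mem_of_smul_eq (h3 _ oppAut_mem_trialityGroup) hk)
      refine Prod.ext k1 (Prod.ext ?_ k3)
      have := congrArg (invConj M) k2
      simpa using this
    · intro x hx
      exact (orbitCon K h3).symm (h x hx)

namespace IsMinInvariant

variable {c : Con M} {K : Subgroup (PermTriple M)}

theorem swapAut_mem (hK : IsMinInvariant c K) {k : PermTriple M} (hk : k ∈ K) : swapAut M k ∈ K :=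
  Subgroup.apply_mem_of_smul_eq (hK.smul_eq _ swapAut_mem_trialityGroup) hk

theorem oppAut_mem (hK : IsMinInvariant c K) {k : PermTriple M} (hk : k ∈ K) : oppAut M k ∈ K :=
  Subgroup.apply_mem_of_smul_eq (hK.smul_eq _ oppAut_mem_trialityGroup) hk

theorem rotAut_mem (hK : IsMinInvariant c K) {k : PermTriple M} (hk : k ∈ K) : rotAut M k ∈ K :=
  Subgroup.apply_mem_of_smul_eq (hK.smul_eq _ rotAut_mem_trialityGroup) hk

theorem moufangTriple_mem (hK : IsMinInvariant c K) {x : M} (hx : c x 1) : moufangTriple x ∈ K := by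
  obtain ⟨k, hk, h⟩ := hK.exists_apply_one (inv x) (by simpa [inv_one] using con_inv c hx)
  have h1 := oppAut_mul_inv (hK.le_autotopisms (hK.swapAut_mem hk))
  rw [swapAut_apply, h, inv_inv] at h1
  rw [← h1]
  exact mul_mem (hK.oppAut_mem (hK.swapAut_mem hk)) (inv_mem (hK.swapAut_mem hk))

theorem con_apply_three (hK : IsMinInvariant c K) {k : PermTriple M} (hk : k ∈ K)
    (x : M) : c (k.2.2 x) x :=
  hK.con_apply _ (hK.swapAut_mem hk) x

end IsMinInvariant

end Invariant

end MoufangLoop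

theorem AddCommGroup.exists_addEquiv_zmod_of_nsmul_eq_zero {A : Type*} [AddCommGroup A] [Finite A]
    {p : ℕ} [Fact p.Prime] (h : ∀ x : A, p • x = 0) :
    ∃ k : ℕ, Nonempty (A ≃+ (Fin k → ZMod p)) := by
  obtain ⟨_⟩ : Nonempty (Module (ZMod p) A) := ⟨AddCommGroup.zmodModule h⟩
  exact ⟨_, ⟨(Module.finBasis (ZMod p) A).equivFun.toAddEquiv⟩⟩

namespace MoufangLoop

section Groups

/-- A group as a Moufang loop. -/
@[reducible]
def ofGroup (G : Type*) [Group G] : MoufangLoop G where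
  one_mul := _root_.one_mul
  mul_one := _root_.mul_one
  existsUnique_mul_left a b := ⟨a⁻¹ * b, by simp, fun y h => by simp [← h]⟩
  existsUnique_mul_right a b := ⟨b * a⁻¹, by simp, fun y h => by simp [← h]⟩
  moufang x y z := by simp only [mul_assoc]

theorem isSimpleLoop_ofGroup {G : Type*} [Group G]
    (h : ∀ H : Subgroup G, H.Normal → H = ⊥ ∨ H = ⊤) :
    @IsSimpleLoop G (ofGroup G) := by
  let := ofGroup G
  intro D hD hDn
  have hinv : ∀ x ∈ D, x⁻¹ ∈ D := by
    intro x hx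
    have h1 := hD.2.2.1 x hx 1 hD.1
    have h2 : x⁻¹ = lsol x 1 := inv_eq_of_mul_eq_one_right (mul_lsol x 1)
    rwa [h2]
  let H : Subgroup G :=
    { carrier := D
      one_mem' := hD.1
      mul_mem' := fun {x y} hx hy => hD.2.1 x hx y hy
      inv_mem' := fun {x} hx => hinv x hx }
  have hH : H.Normal := by
    refine ⟨fun d hd x => ?_⟩
    have h1 : x * d ∈ ({x} : Set G) * D := ⟨x, rfl, d, hd, rfl⟩
    rw [← hDn.2.1 x (Set.mem_univ x)] at h1
    obtain ⟨e, he, y, hy, h2⟩ := h1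
    have h3 : e * x = x * d := by
      rw [Set.mem_singleton_iff.1 hy] at h2
      exact h2
    rw [← h3, mul_inv_cancel_right]
    exact he
  rcases h H hH with h1 | h1
  · exact Or.inl (congrArg (fun H : Subgroup G => (H : Set G)) h1)
  · exact Or.inr (congrArg (fun H : Subgroup G => (H : Set G)) h1)

theorem isSimpleLoop_multiplicative_zmod (p : ℕ) [hp : Fact p.Prime] :
    @IsSimpleLoop (Multiplicative (ZMod p)) (ofGroup _) := by
  refine isSimpleLoop_ofGroup fun H _ => ?_
  have hc : Nat.card (Multiplicative (ZMod p)) = p := by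
    rw [Nat.card_congr Multiplicative.toAdd, Nat.card_zmod]
  have : Fact (Nat.card (Multiplicative (ZMod p))).Prime := ⟨by rw [hc]; exact hp.1⟩
  exact H.eq_bot_or_eq_top_of_prime_card

variable {M : Type*} [MoufangLoop M]

/-- A subloop on which the multiplication is commutative and associative is a commutative
group. -/
@[reducible]
noncomputable def IsSubloopSet.commGroup {N : Set M} (hN : IsSubloopSet N)
    (hcomm : ∀ x ∈ N, ∀ y ∈ N, x * y = y * x)
    (hassoc : ∀ x ∈ N, ∀ y ∈ N, ∀ z ∈ N, (x * y) * z = x * (y * z)) : CommGroup N where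
  mul x y := ⟨x * y, hN.2.1 x x.2 y y.2⟩
  one := ⟨1, hN.1⟩
  inv x := ⟨inv x, hN.inv_mem x.2⟩
  mul_assoc x y z := Subtype.ext (hassoc x x.2 y y.2 z z.2)
  one_mul x := Subtype.ext (one_mul _)
  mul_one x := Subtype.ext (mul_one _)
  inv_mul_cancel x := Subtype.ext (inv_mul _)
  mul_comm x y := Subtype.ext (hcomm x x.2 y y.2)

theorem IsSubloopSet.exists_isDirectPowerOf_zmod [Finite M] {N : Set M} (hN : IsSubloopSet N)
    (hcomm : ∀ x ∈ N, ∀ y ∈ N, x * y = y * x)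
    (hassoc : ∀ x ∈ N, ∀ y ∈ N, ∀ z ∈ N, (x * y) * z = x * (y * z))
    {p : ℕ} [Fact p.Prime] (hp : ∀ x ∈ N, (mulLeftPerm x ^ p) 1 = 1) :
    ∃ k : ℕ, @IsDirectPowerOf M _ N k (Multiplicative (ZMod p)) (ofGroup _) := by
  let := hN.commGroup hcomm hassoc
  have hpow : ∀ (x : N) (n : ℕ), ((x ^ n : N) : M) = (mulLeftPerm (x : M) ^ n) 1 := by
    intro x n
    induction n with
    | zero => rfl
    | succ n ih =>
      rw [pow_succ', pow_succ', Equiv.Perm.mul_apply, ← ih]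
      rfl
  obtain ⟨k, ⟨e⟩⟩ := AddCommGroup.exists_addEquiv_zmod_of_nsmul_eq_zero
    (A := Additive N) (p := p) fun x =>
      Subtype.ext ((hpow (Additive.toMul x) p).trans (hp _ (Additive.toMul x).2))
  refine ⟨k, fun u => ((Additive.toMul (e.symm fun i => Multiplicative.toAdd (u i)) : N) : M),
    ?_, ?_, ?_⟩
  · intro u v h
    have h1 := e.symm.injective (Additive.toMul.injective (Subtype.ext h))
    exact funext fun i => congrFun h1 i
  · ext x
    constructor
    · rintro ⟨u, rfl⟩
      exact Subtype.coe_prop _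
    · intro hx
      refine ⟨fun i => Multiplicative.ofAdd (e (Additive.ofMul ⟨x, hx⟩) i), ?_⟩
      change ((Additive.toMul (e.symm (e (Additive.ofMul ⟨x, hx⟩))) : N) : M) = x
      rw [e.symm_apply_apply]
      rfl
  · intro u v
    have h1 := map_add e.symm (fun i => Multiplicative.toAdd (u i))
      (fun i => Multiplicative.toAdd (v i))
    exact congrArg (fun z : Additive N => ((Additive.toMul z : N) : M)) h1

end Groups

section Abelian

variable {M : Type*} [MoufangLoop M] {c : Con M} {K : Subgroup (PermTriple M)}

theorem IsMinInvariant.mul_comm_of_commutative (hK : IsMinInvariant c K)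
    (h : ∀ k ∈ K, ∀ l ∈ K, k * l = l * k) {x y : M} (hx : c x 1) (hy : c y 1) :
    x * y = y * x := by
  have h1 := congrArg (fun k : PermTriple M => k.1 1)
    (h _ (hK.moufangTriple_mem hx) _ (hK.moufangTriple_mem hy))
  simpa [moufangTriple, mul_one] using h1

theorem IsMinInvariant.mul_assoc_of_commutative (hK : IsMinInvariant c K)
    (h : ∀ k ∈ K, ∀ l ∈ K, k * l = l * k) {x z : M} (hx : c x 1) (hz : c z 1) (y : M) :
    (x * y) * z = x * (y * z) := by
  have h1 := congrArg (fun k : PermTriple M => k.1 y) (h _ (hK.moufangTriple_mem hx) _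
    (hK.rotAut_mem (hK.rotAut_mem (hK.moufangTriple_mem hz))))
  rw [rotAut_rotAut_moufangTriple] at h1
  simpa [moufangTriple] using h1.symm

theorem IsMinInvariant.exists_prime_pow_eq_one [Finite M] (hK : IsMinInvariant c K)
    (h : ∀ k ∈ K, ∀ l ∈ K, k * l = l * k) : ∃ p : ℕ, p.Prime ∧ ∀ k ∈ K, k ^ p = 1 := by
  have hcard : Nat.card K ≠ 1 := fun h1 => hK.ne_bot (Subgroup.card_eq_one.1 h1)
  obtain ⟨p, hp, hdvd⟩ := Nat.exists_prime_and_dvd hcard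
  have : Fact p.Prime := ⟨hp⟩
  obtain ⟨x, hx⟩ := exists_prime_orderOf_dvd_card' p hdvd
  let Y : Subgroup (PermTriple M) :=
    { carrier := {k | k ∈ K ∧ k ^ p = 1}
      one_mem' := ⟨one_mem _, one_pow _⟩
      mul_mem' := fun {k l} hk hl => ⟨mul_mem hk.1 hl.1, by
        rw [(show Commute k l from h k hk.1 l hl.1).mul_pow, hk.2, hl.2, _root_.one_mul]⟩
      inv_mem' := fun {k} hk => ⟨inv_mem hk.1, by rw [inv_pow, hk.2, _root_.inv_one]⟩ }
  have hY : ∀ a ∈ trialityGroup M, a • Y = Y :=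
    Subgroup.smul_eq_of_forall_mem fun a ha y hy =>
      ⟨Subgroup.apply_mem_of_smul_eq (hK.smul_eq a ha) hy.1, by
        rw [← map_pow, hy.2, map_one]⟩
  have hxY : (x : PermTriple M) ∈ Y := ⟨x.2, by
    rw [← Subgroup.coe_pow, ← hx, pow_orderOf_eq_one, Subgroup.coe_one]⟩
  rcases hK.minimal Y (fun k hk => hk.1) hY with h1 | h1
  · rw [h1, Subgroup.mem_bot] at hxY
    rw [Subtype.ext (a1 := x) (a2 := 1) hxY, orderOf_one] at hx
    exact absurd hx.symm hp.ne_one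
  · refine ⟨p, hp, fun k hk => ?_⟩
    rw [← h1] at hk
    exact hk.2

end Abelian

end MoufangLoop

theorem conj_smul_eq_or_reflection_apply_eq {G : Type*} [Group G] {𝒯 : Set (Subgroup G)}
    (hcomm : ∀ U ∈ 𝒯, ∀ V ∈ 𝒯, U ≠ V → ∀ u ∈ U, ∀ v ∈ V, u * v = v * u)
    (hsimple : ∀ U ∈ 𝒯, IsNonabelianSimple U) {t ρ : MulAut G}
    (ht : ∀ U ∈ 𝒯, t • U ∈ 𝒯) (hρ : ∀ U ∈ 𝒯, ρ • U ∈ 𝒯) (hρ3 : ρ * ρ * ρ = 1)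
    (htri : ∀ U ∈ 𝒯, ∀ k ∈ U,
      t k * k⁻¹ * ρ (t k * k⁻¹) * ρ (ρ (t k * k⁻¹)) = 1)
    {U : Subgroup G} (htU : t • U = U) (hρU : ρ • U = U) {m : G} (hm : t m = m⁻¹)
    (hm3 : m * ρ m * ρ (ρ m) = 1) (hmc : Commute m (ρ m)) (hV : MulAut.conj m • U ∈ 𝒯) :
    MulAut.conj m • U = U ∨ ∀ k ∈ MulAut.conj m • U, t k = k := by
  let S : Subgroup G := (MulAction.stabilizer (MulAut G) U).comap MulAut.conj
  have hS : ∀ x, x ∈ S ↔ MulAut.conj x • U = U := fun x => Iff.rfl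
  have hSS : ∀ x y, MulAut.conj x • U = MulAut.conj y • U ↔ y⁻¹ * x ∈ S := by
    intro x y
    rw [hS, map_mul, map_inv, mul_smul, inv_smul_eq_iff]
  have hq : ∀ (q : MulAut G) (x : G), q • U = U →
      q • MulAut.conj x • U = MulAut.conj (q x) • U := by
    intro q x h
    have e : q * MulAut.conj x = MulAut.conj (q x) * q :=
      MulEquiv.ext fun k => by simp
    rw [← mul_smul, e, mul_smul, h]
  have hρS : ∀ x, ρ x ∈ S ↔ x ∈ S := by
    intro x
    rw [hS, ← hq ρ x hρU, hS, smul_eq_iff_eq_inv_smul, inv_smul_eq_iff.2 hρU.symm]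
  have hd : ρ (ρ m) = (m * ρ m)⁻¹ := (inv_eq_of_mul_eq_one_right hm3).symm
  have h1 : t • MulAut.conj m • U = MulAut.conj m⁻¹ • U := by rw [hq t m htU, hm]
  rcases reflection_smul_eq hcomm hsimple ht hρ hρ3 htri hV with h | h | h
  · by_cases hρV : ρ • MulAut.conj m • U = MulAut.conj m • U
    · left
      have e1 : m⁻¹ * m⁻¹ ∈ S := by rwa [← hSS, ← h1]
      have e2 : m⁻¹ * ρ m ∈ S := by rwa [← hSS, ← hq ρ m hρU]
      have e3 : m⁻¹ * ρ (ρ m) ∈ S := by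
        rw [← hSS, ← hq ρ _ hρU, ← hq ρ m hρU, hρV, hρV]
      have e4 : m⁻¹ * ρ (ρ m) = (m * m * (m⁻¹ * ρ m) * m)⁻¹ := by
        rw [hd]
        group
      rw [e4, inv_mem_iff] at e3
      have e5 : m * m ∈ S := by
        rw [← inv_mem_iff, mul_inv_rev]
        exact e1
      exact (Subgroup.mul_mem_cancel_left S (mul_mem e5 e2)).1 e3
    · exact Or.inr fun k hk => reflection_apply_eq hcomm hsimple hρ hρ3 htri hV h hρV hk
  · left
    rw [h1, hq ρ _ hρU, hSS, map_inv, ← mul_inv_rev, ← hmc.eq, ← hd] at h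
    exact (hρS _).1 ((hρS _).1 h)
  · left
    rw [h1, hq ρ _ hρU, hq ρ _ hρU, hSS, map_inv, map_inv, hd, inv_inv,
      inv_mul_cancel_left] at h
    exact (hρS _).1 h

namespace MoufangLoop

section Factors

variable {M : Type*} [MoufangLoop M] {c : Con M} {K : Subgroup (PermTriple M)}
  {𝒯 : Set (Subgroup (PermTriple M))}

/-- `𝒯` is an orbit, under the triality group, of minimal normal subgroups of `K` which are
nonabelian simple and generate `K`. -/
structure IsFactorSet (K : Subgroup (PermTriple M)) (𝒯 : Set (Subgroup (PermTriple M))) :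
    Prop where
  closure_eq : Subgroup.closure {x | ∃ U ∈ 𝒯, x ∈ U} = K
  isMinNormal : ∀ U ∈ 𝒯, IsMinNormal K U
  simple : ∀ U ∈ 𝒯, IsNonabelianSimple U
  smul_mem : ∀ a ∈ trialityGroup M, ∀ U ∈ 𝒯, a • U ∈ 𝒯
  exists_smul_eq : ∀ U ∈ 𝒯, ∀ V ∈ 𝒯, ∃ a : MulAut (PermTriple M), a • U = V

theorem IsMinInvariant.exists_isFactorSet [Finite M] (hK : IsMinInvariant c K)
    (h : ¬ ∀ k ∈ K, ∀ l ∈ K, k * l = l * k) : ∃ 𝒯, IsFactorSet K 𝒯 := by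
  obtain ⟨T, hT⟩ := exists_nonabelianSimple_factors hK.smul_eq hK.minimal h
  obtain ⟨h1, h2, h3⟩ := hT _ rfl
  refine ⟨_, h1, h2, h3, ?_, ?_⟩
  · rintro a ha _ ⟨b, hb, rfl⟩
    exact ⟨a * b, mul_mem ha hb, (mul_smul _ _ _).symm⟩
  · rintro _ ⟨a, -, rfl⟩ _ ⟨b, -, rfl⟩
    exact ⟨b * a⁻¹, by rw [mul_smul, inv_smul_smul]⟩

theorem IsFactorSet.commute (h𝒯 : IsFactorSet K 𝒯) :
    ∀ U ∈ 𝒯, ∀ V ∈ 𝒯, U ≠ V → ∀ u ∈ U, ∀ v ∈ V, u * v = v * u :=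
  fun U hU V hV h => (h𝒯.isMinNormal U hU).commute (h𝒯.isMinNormal V hV) h

theorem IsFactorSet.triality (h𝒯 : IsFactorSet K 𝒯) (hK : IsMinInvariant c K) :
    ∀ U ∈ 𝒯, ∀ k ∈ U, oppAut M k * k⁻¹ * rotAut M (oppAut M k * k⁻¹) *
      rotAut M (rotAut M (oppAut M k * k⁻¹)) = 1 :=
  fun U hU _ hk => triality_of_mem_autotopisms (hK.le_autotopisms ((h𝒯.isMinNormal U hU).le hk))

/-- A factor centralized by the opposite automorphism has trivial third components. -/
theorem IsMinInvariant.apply_three_eq (hK : IsMinInvariant c K) {V : Subgroup (PermTriple M)}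
    (hV : IsMinNormal K V) (h : ∀ k ∈ V, oppAut M k = k) {k : PermTriple M} (hk : k ∈ V)
    {x : M} (hx : c x 1) : k.2.2 x = x := by
  have key : ∀ l ∈ V, l.2.2 1 = 1 := by
    intro l hl
    have h1 := oppAut_mul_inv (hK.le_autotopisms (hV.le hl))
    rw [h l hl, mul_inv_cancel, ← moufangTriple_one] at h1
    rw [← inv_inv (l.2.2 1), ← moufangTriple_injective h1, inv_one]
  obtain ⟨l, hl, rfl⟩ := hK.exists_apply_one x hx
  have h1 := key _ (hV.normal _ (inv_mem (hK.swapAut_mem hl)) k hk)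
  rw [_root_.inv_inv] at h1
  change (l.1⁻¹ * k.2.2 * l.1) 1 = 1 at h1
  rw [mul_assoc, Equiv.Perm.mul_apply, Equiv.Perm.inv_eq_iff_eq] at h1
  exact h1

theorem IsMinInvariant.eq_of_smul_eq (hK : IsMinInvariant c K) (h𝒯 : IsFactorSet K 𝒯)
    {U : Subgroup (PermTriple M)} (hU : U ∈ 𝒯) (htU : oppAut M • U = U)
    (hρU : rotAut M • U = U) (hne : ∃ k ∈ U, ∃ x, c x 1 ∧ k.1 x ≠ x) : U = K := by
  have hle := (h𝒯.isMinNormal U hU).le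
  have htU' : ∀ k ∈ U, oppAut M k ∈ U := fun k hk => Subgroup.apply_mem_of_smul_eq htU hk
  have hρU' : ∀ k ∈ U, rotAut M k ∈ U := fun k hk => Subgroup.apply_mem_of_smul_eq hρU hk
  have hsU : ∀ k ∈ U, swapAut M k ∈ U := fun k hk => by
    rw [← rotAut_mul_oppAut]
    exact hρU' _ (htU' k hk)
  have hconj : ∀ x : M, MulAut.conj (moufangTriple x) • U = U := by
    intro x
    have hVm := h𝒯.smul_mem _ (conj_mem_trialityGroup x) U hU
    refine (conj_smul_eq_or_reflection_apply_eq h𝒯.commute h𝒯.simple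
      (h𝒯.smul_mem _ oppAut_mem_trialityGroup) (h𝒯.smul_mem _ rotAut_mem_trialityGroup)
      rotAut_pow_three (h𝒯.triality hK) htU hρU (oppAut_moufangTriple x)
      (moufangTriple_mul_rotAut x) (commute_moufangTriple_rotAut x) hVm).resolve_right
      fun hfix => ?_
    have hQ : ∀ u ∈ U, ∀ p, c ((x * p) * x) 1 → u.2.2 p = p := by
      intro u hu p hp
      have h1 := hK.apply_three_eq (h𝒯.isMinNormal _ hVm) hfix
        (Subgroup.smul_mem_pointwise_smul u (MulAut.conj (moufangTriple x)) U hu) hp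
      change (mulRightPerm x * mulLeftPerm x) (u.2.2 ((mulRightPerm x * mulLeftPerm x).symm
        ((mulRightPerm x * mulLeftPerm x) p))) = (mulRightPerm x * mulLeftPerm x) p at h1
      rw [Equiv.symm_apply_apply] at h1
      exact (mulRightPerm x * mulLeftPerm x).injective h1
    have hreg : ∀ u ∈ U, u.1 1 = 1 → ∀ n, c n 1 → u.1 n = n := by
      intro u hu h1 n hn
      have hp0 : (x * (inv x * inv x)) * x = 1 := by rw [mul_inv_mul, inv_mul]
      have hq := hQ u hu (inv n * (inv x * inv x)) (by
        have h2 : c (inv n * (inv x * inv x)) (inv x * inv x) := by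
          simpa only [inv_one, one_mul] using c.mul (con_inv c hn) (c.refl (inv x * inv x))
        have h3 := c.mul (c.mul (c.refl x) h2) (c.refl x)
        rwa [hp0] at h3)
      have hatp := mem_autotopisms.1 (hK.le_autotopisms (hle hu))
      have h2 := hatp 1 (inv n * (inv x * inv x))
      rw [h1, one_mul, one_mul, hq] at h2
      have h3 := hatp n (inv n * (inv x * inv x))
      rw [h2, mul_inv_mul, hQ u hu _ (by rw [hp0]; exact c.refl 1)] at h3
      refine mul_right_cancel' (a := inv n * (inv x * inv x)) ?_
      rw [h3, mul_inv_mul]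
    have hm : ∀ u ∈ U, moufangTriple (u.1 1) ∈ U := by
      intro u hu
      have h1 := oppAut_mul_inv (hK.le_autotopisms (hle (hsU u hu)))
      have h2 := mul_mem (htU' _ (hsU u hu)) (inv_mem (hsU u hu))
      rw [h1] at h2
      change moufangTriple (inv (u.1 1)) ∈ U at h2
      rwa [moufangTriple_inv, inv_mem_iff] at h2
    have hN1 : ∀ u ∈ U, c (u.1 1) 1 := fun u hu => hK.con_apply u (hle hu) 1
    have hl : ∀ u ∈ U, ∀ n, c n 1 → u.1 n = u.1 1 * n := by
      intro u hu n hn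
      have h1 := hreg _ (mul_mem (inv_mem (hm u hu)) hu) (inv_mul _) n hn
      change inv (u.1 1) * u.1 n = n at h1
      rw [← mul_inv_mul (u.1 1) (u.1 n), h1]
    have hr : ∀ u ∈ U, ∀ n, c n 1 → u.1 n = n * u.1 1 := by
      intro u hu n hn
      have h0 := hρU' _ (hρU' _ (hm u hu))
      rw [rotAut_rotAut_moufangTriple] at h0
      have h1 := hreg _ (mul_mem (inv_mem h0) hu) (mul_inv _) n hn
      change u.1 n * inv (u.1 1) = n at h1
      rw [← mul_inv_mul_right (u.1 1) (u.1 n), h1]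
    let Y : Subgroup (PermTriple M) :=
      { carrier := {u | u ∈ U ∧ ∀ n, c n 1 → u.1 n = n}
        one_mem' := ⟨one_mem _, fun _ _ => rfl⟩
        mul_mem' := fun {u v} hu hv => ⟨mul_mem hu.1 hv.1, fun n hn => by
          rw [Prod.fst_mul, Equiv.Perm.mul_apply, hv.2 n hn, hu.2 n hn]⟩
        inv_mem' := fun {u} hu => ⟨inv_mem hu.1, fun n hn => by
          rw [Prod.fst_inv, Equiv.Perm.inv_eq_iff_eq, hu.2 n hn]⟩ }
    rcases (h𝒯.simple U hU).simple Y (fun u hu => hu.1) (fun v hv y hy =>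
      ⟨mul_mem (mul_mem hv hy.1) (inv_mem hv), fun n hn => by
        change v.1 (y.1 (v⁻¹.1 n)) = n
        rw [hy.2 _ (c.trans (hK.con_apply _ (hle (inv_mem hv)) n) hn)]
        change v.1 (v.1⁻¹ n) = n
        simp⟩) with hY | hY
    · refine (h𝒯.simple U hU).nonabelian fun u hu v hv => ?_
      have h1 : (v * u)⁻¹ * (u * v) ∈ U :=
        mul_mem (inv_mem (mul_mem hv hu)) (mul_mem hu hv)
      have h2 : (v * u)⁻¹ * (u * v) ∈ Y := ⟨h1, hreg _ h1 (by
        change (v.1 * u.1)⁻¹ (u.1 (v.1 1)) = 1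
        rw [Equiv.Perm.inv_eq_iff_eq, Equiv.Perm.mul_apply, hl u hu _ (hN1 v hv),
          hr v hv _ (hN1 u hu)])⟩
      rw [hY, Subgroup.mem_bot, inv_mul_eq_one] at h2
      exact h2.symm
    · obtain ⟨k, hk, n, hn, hkn⟩ := hne
      rw [← hY] at hk
      exact hkn (hk.2 n hn)
  refine (hK.minimal U hle (smul_eq_of_mem_trialityGroup hsU htU' fun x k hk =>
    Subgroup.apply_mem_of_smul_eq (hconj x) hk)).resolve_left (h𝒯.isMinNormal U hU).ne_bot

/-- If `K` is nonabelian simple, then the class of `1` is a simple loop. -/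
theorem IsMinInvariant.eq_one_or_eq (hK : IsMinInvariant c K) (hKs : IsNonabelianSimple K)
    (hc : ∃ x, x ≠ 1 ∧ c x 1) {D : Set M} (hD : IsSubloopSet D)
    (hDn : IsNormalIn D {x | c x 1}) : D = {1} ∨ D = {x | c x 1} := by
  have hN : IsSubloopSet {x | c x 1} := isSubloopSet_con c
  have hcK : ∀ k ∈ K, ∀ x, c x 1 → c (k.1 x) 1 := fun k hk x hx =>
    c.trans (hK.con_apply k hk x) hx
  have hρ : ∀ q : MulAut (PermTriple M), q ∈ trialityGroup M → ∀ k ∈ K, q k ∈ K :=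
    fun q hq k hk => Subgroup.apply_mem_of_smul_eq (hK.smul_eq q hq) hk
  let W : Subgroup (PermTriple M) := Subgroup.closure
    {g | ∃ q ∈ trialityGroup M, (∀ x, q (moufangTriple x) = moufangTriple x ∨
      q (moufangTriple x) = rotAut M (moufangTriple x) ∨
      q (moufangTriple x) = rotAut M (rotAut M (moufangTriple x))) ∧
      ∃ x, c x 1 ∧ g = q (moufangTriple x)}
  have hWK : W ≤ K := by
    rw [Subgroup.closure_le]
    rintro _ ⟨q, hq, -, x, hx, rfl⟩
    exact hρ q hq _ (hK.moufangTriple_mem hx)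
  have hWm : ∀ x, c x 1 → moufangTriple x ∈ W := fun x hx =>
    Subgroup.subset_closure ⟨1, one_mem _, fun _ => Or.inl rfl, x, hx, rfl⟩
  have hWn : ∀ h ∈ K, ∀ w ∈ W, h * w * h⁻¹ ∈ W := by
    intro h hh w hw
    induction hw using Subgroup.closure_induction with
    | one => simp [one_mem]
    | mul a b _ _ ha hb =>
      have e : h * (a * b) * h⁻¹ = h * a * h⁻¹ * (h * b * h⁻¹) := by group
      rw [e]
      exact mul_mem ha hb
    | inv a _ ha =>
      have e : h * a⁻¹ * h⁻¹ = (h * a * h⁻¹)⁻¹ := by group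
      rw [e]
      exact inv_mem ha
    | mem g hg =>
      obtain ⟨q, hq, hq3, x, hx, rfl⟩ := hg
      have hqW : ∀ y, c y 1 → q (moufangTriple y) ∈ W := fun y hy =>
        Subgroup.subset_closure ⟨q, hq, hq3, y, hy, rfl⟩
      obtain ⟨k, hk, hkx⟩ := hK.exists_apply_one (inv x) (hN.inv_mem hx)
      have hl : swapAut M k ∈ K := hK.swapAut_mem hk
      have e0 := oppAut_mul_inv (hK.le_autotopisms hl)
      rw [swapAut_apply, hkx, inv_inv, ← swapAut_apply] at e0
      have hj : q⁻¹ h ∈ K := hρ _ (inv_mem hq) h hh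
      have e1 := oppAut_mul_inv (hK.le_autotopisms hj)
      have e2 := oppAut_mul_inv (hK.le_autotopisms (mul_mem hj hl))
      have e3 : q⁻¹ h * moufangTriple x * (q⁻¹ h)⁻¹ =
          (moufangTriple (inv ((q⁻¹ h).2.2 1)))⁻¹ *
            moufangTriple (inv ((q⁻¹ h * swapAut M k).2.2 1)) := by
        rw [← e0, ← e1, ← e2, map_mul]
        group
      have e4 : h * q (moufangTriple x) * h⁻¹ =
          q (q⁻¹ h * moufangTriple x * (q⁻¹ h)⁻¹) := by
        simp
      rw [e4, e3, map_mul, map_inv]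
      exact mul_mem (inv_mem (hqW _ (hN.inv_mem (hK.con_apply_three hj 1))))
        (hqW _ (hN.inv_mem (hK.con_apply_three (mul_mem hj hl) 1)))
  have hW : W = K := by
    refine (hKs.simple W hWK hWn).resolve_left fun h => ?_
    obtain ⟨x, hx1, hx⟩ := hc
    have h1 := hWm x hx
    rw [h, Subgroup.mem_bot, ← moufangTriple_one] at h1
    exact hx1 (moufangTriple_injective h1)
  let E : Subgroup (PermTriple M) :=
    { carrier := {k | k ∈ K ∧ ∀ x y, c x 1 → c y 1 →
        (({k.1 x} : Set M) * D = {k.1 y} * D ↔ ({x} : Set M) * D = {y} * D)}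
      one_mem' := ⟨one_mem _, fun _ _ _ _ => Iff.rfl⟩
      mul_mem' := fun {k l} hk hl => ⟨mul_mem hk.1 hl.1, fun x y hx hy =>
        (hk.2 _ _ (hcK l hl.1 x hx) (hcK l hl.1 y hy)).trans (hl.2 x y hx hy)⟩
      inv_mem' := fun {k} hk => ⟨inv_mem hk.1, fun x y hx hy => by
        have h1 := hk.2 _ _ (hcK _ (inv_mem hk.1) x hx) (hcK _ (inv_mem hk.1) y hy)
        simpa using h1.symm⟩ }
  have hE1 : ∀ n, c n 1 → moufangTriple n ∈ E := by
    have h0 : ∀ n x y, c n 1 → c x 1 → c y 1 → ({x} : Set M) * D = {y} * D →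
        ({n * x} : Set M) * D = {n * y} * D := by
      intro n x y hn hx hy h
      rw [(hDn.singleton_mul hN hn hx).1, h, (hDn.singleton_mul hN hn hy).1]
    refine fun n hn => ⟨hK.moufangTriple_mem hn, fun x y hx hy => ⟨fun h => ?_, h0 n x y hn hx hy⟩⟩
    have h1 := h0 (inv n) (n * x) (n * y) (hN.inv_mem hn) (hN.2.1 n hn x hx)
      (hN.2.1 n hn y hy) h
    rwa [inv_mul_mul, inv_mul_mul] at h1
  have hE2 : ∀ n, c n 1 → rotAut M (rotAut M (moufangTriple n)) ∈ E := by
    have h0 : ∀ n x y, c n 1 → c x 1 → c y 1 → ({x} : Set M) * D = {y} * D →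
        ({x * n} : Set M) * D = {y * n} * D := by
      intro n x y hn hx hy h
      rw [(hDn.singleton_mul hN hx hn).2, h, (hDn.singleton_mul hN hy hn).2]
    refine fun n hn => ⟨hK.rotAut_mem (hK.rotAut_mem (hK.moufangTriple_mem hn)), ?_⟩
    rw [rotAut_rotAut_moufangTriple]
    refine fun x y hx hy => ⟨fun h => ?_, h0 n x y hn hx hy⟩
    have h1 := h0 (inv n) (x * n) (y * n) (hN.inv_mem hn) (hN.2.1 x hx n hn)
      (hN.2.1 y hy n hn) h
    rwa [mul_mul_inv, mul_mul_inv] at h1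
  have hE3 : ∀ n, c n 1 → rotAut M (moufangTriple n) ∈ E := by
    intro n hn
    have h1 := moufangTriple_mul_rotAut n
    rw [mul_assoc] at h1
    rw [eq_mul_inv_of_mul_eq (eq_inv_of_mul_eq_one_right h1)]
    exact mul_mem (inv_mem (hE1 n hn)) (inv_mem (hE2 n hn))
  have hKE : ∀ k ∈ K, k ∈ E := by
    intro k hk
    rw [← hW] at hk
    refine (Subgroup.closure_le E).2 ?_ hk
    rintro _ ⟨q, -, hq3, x, hx, rfl⟩
    rcases hq3 x with h | h | h
    · rw [h]; exact hE1 x hx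
    · rw [h]; exact hE3 x hx
    · rw [h]; exact hE2 x hx
  let Y : Subgroup (PermTriple M) :=
    { carrier := {k | k ∈ K ∧ ∀ x, c x 1 → ({k.1 x} : Set M) * D = {x} * D}
      one_mem' := ⟨one_mem _, fun _ _ => rfl⟩
      mul_mem' := fun {k l} hk hl => ⟨mul_mem hk.1 hl.1, fun x hx =>
        (hk.2 _ (hcK l hl.1 x hx)).trans (hl.2 x hx)⟩
      inv_mem' := fun {k} hk => ⟨inv_mem hk.1, fun x hx => by
        have h1 := hk.2 _ (hcK _ (inv_mem hk.1) x hx)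
        simpa using h1.symm⟩ }
  rcases hKs.simple Y (fun k hk => hk.1) (fun h hh k hk =>
    ⟨mul_mem (mul_mem hh hk.1) (inv_mem hh), fun x hx => by
      have hx' := hcK _ (inv_mem hh) x hx
      have h1 := ((hKE h hh).2 _ _ (hcK k hk.1 _ hx') hx').2 (hk.2 _ hx')
      simpa using h1⟩) with hY | hY
  · left
    refine Set.eq_singleton_iff_unique_mem.2 ⟨hD.1, fun d hd => ?_⟩
    have h1 : moufangTriple d ∈ Y := ⟨hK.moufangTriple_mem (hDn.1 hd), fun x hx => by
      change ({d * x} : Set M) * D = {x} * D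
      rw [(hDn.singleton_mul hN (hDn.1 hd) hx).2, hD.singleton_mul.2 hd,
        ← (hDn.singleton_mul hN hN.1 hx).2, one_mul]⟩
    rw [hY, Subgroup.mem_bot, ← moufangTriple_one] at h1
    exact moufangTriple_injective h1
  · right
    refine Set.Subset.antisymm hDn.1 fun x hx => ?_
    have h1 : moufangTriple x ∈ Y := by
      rw [hY]
      exact hK.moufangTriple_mem hx
    have h2 := h1.2 1 (c.refl 1)
    change ({x * 1} : Set M) * D = {1} * D at h2
    rwa [mul_one, hD.singleton_mul] at h2

end Factors

end MoufangLoop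

namespace MoufangLoop

theorem isSimpleLoop_of_isNonabelianSimple {G : Type*} [Group G] {T : Subgroup G}
    (hT : IsNonabelianSimple T) : @IsSimpleLoop T (ofGroup T) := by
  refine isSimpleLoop_ofGroup fun H hH => ?_
  rcases hT.simple (H.map T.subtype) (Subgroup.map_subtype_le H) (by
    rintro v hv _ ⟨y, hy, rfl⟩
    exact ⟨⟨v, hv⟩ * y * ⟨v, hv⟩⁻¹, hH.conj_mem y hy _, rfl⟩) with h | h
  · exact Or.inl ((Subgroup.map_eq_bot_iff_of_injective H T.subtype_injective).1 h)
  · right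
    refine (Subgroup.eq_top_iff' H).2 fun x => ?_
    have hx : (x : G) ∈ H.map T.subtype := by
      rw [h]
      exact x.2
    obtain ⟨y, hy, hxy⟩ := hx
    rwa [← Subtype.ext (a1 := y) (a2 := x) hxy]

theorem exists_isDirectPowerOf_of_pi {M : Type*} [MoufangLoop M] {N : Set M} {ι T : Type*}
    [Finite ι] [Group T] {H : ι → Type*} [∀ i, Group (H i)] (e : ∀ i, T ≃* H i)
    (f : (∀ i, H i) → M) (hf : Function.Injective f) (hfN : Set.range f = N)
    (hmul : ∀ u v, f (u * v) = f u * f v) :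
    ∃ k, @IsDirectPowerOf M _ N k T (ofGroup T) := by
  let σ := Finite.equivFin ι
  refine ⟨Nat.card ι, fun w => f fun i => e i (w (σ i)), ?_, ?_, ?_⟩
  · intro u v h
    refine funext fun j => ?_
    have h1 := congrFun (hf h) (σ.symm j)
    simpa using h1
  · rw [← hfN]
    refine Set.Subset.antisymm ?_ ?_
    · rintro _ ⟨w, rfl⟩
      exact ⟨_, rfl⟩
    · rintro _ ⟨w, rfl⟩
      refine ⟨fun j => (e (σ.symm j)).symm (w (σ.symm j)), congrArg f (funext fun i => ?_)⟩
      have key : ∀ j, σ.symm j = i → (e i) ((e (σ.symm j)).symm (w (σ.symm j)) : T) = w i := by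
        rintro j rfl
        simp
      exact key _ (σ.symm_apply_apply i)
  · intro u v
    rw [← hmul]
    exact congrArg f (funext fun i => map_mul (e i) _ _)

section Semiregular

variable {M : Type*} [MoufangLoop M] {c : Con M} {K : Subgroup (PermTriple M)}
  {𝒯 : Set (Subgroup (PermTriple M))}

/-- Either some factor is invariant under the triality automorphisms and acts nontrivially
on the class of `1`, or every factor has a component acting trivially on this class. -/
theorem IsMinInvariant.apply_eq_of_factor (hK : IsMinInvariant c K) (h𝒯 : IsFactorSet K 𝒯)
    {U : Subgroup (PermTriple M)} (hU : U ∈ 𝒯)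
    (hfix : oppAut M • U = U → rotAut M • U = U → ∀ k ∈ U, ∀ x, c x 1 → k.1 x = x) :
    (∀ k ∈ U, ∀ x, c x 1 → k.1 x = x) ∨ (∀ k ∈ U, ∀ x, c x 1 → k.2.1 x = x) ∨
      ∀ k ∈ U, ∀ x, c x 1 → k.2.2 x = x := by
  have hρ := h𝒯.smul_mem _ (rotAut_mem_trialityGroup (M := M))
  have hconj : ∀ α : Equiv.Perm M, (∀ x, c x 1 → invConj M α x = x) → ∀ x, c x 1 → α x = x := by
    intro α h x hx
    have h1 := h (inv x) (by simpa only [inv_one] using con_inv c hx)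
    rw [invConj_apply, inv_inv] at h1
    rw [← inv_inv (α x), h1, inv_inv]
  rcases smul_eq_or_reflection_apply_eq h𝒯.commute h𝒯.simple
    (h𝒯.smul_mem _ oppAut_mem_trialityGroup) hρ rotAut_pow_three oppAut_mul_rotAut
    (h𝒯.triality hK) hU with h | h | h | h
  · exact Or.inl (hfix h.1 h.2)
  · exact Or.inr (Or.inr fun k hk x hx => hK.apply_three_eq (h𝒯.isMinNormal U hU) h hk hx)
  · refine Or.inr (Or.inl fun k hk => hconj _ fun x hx => ?_)
    refine hK.apply_three_eq (h𝒯.isMinNormal _ (hρ U hU)) ?_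
      (Subgroup.smul_mem_pointwise_smul k (rotAut M) U hk) hx
    rintro _ ⟨l, hl, rfl⟩
    change oppAut M (rotAut M l) = rotAut M l
    have e : rotAut M (oppAut M (rotAut M (oppAut M l))) = l := by rw [h l hl, h l hl]
    conv_lhs => rw [← h l hl]
    simp
  · refine Or.inl fun k hk => hconj _ fun x hx => ?_
    have h1 := hK.apply_three_eq (h𝒯.isMinNormal _ (hρ _ (hρ U hU))) ?_
      (Subgroup.smul_mem_pointwise_smul _ (rotAut M) _
        (Subgroup.smul_mem_pointwise_smul k (rotAut M) U hk)) hx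
    · simpa using h1
    · rintro _ ⟨_, ⟨l, hl, rfl⟩, rfl⟩
      change oppAut M (rotAut M (rotAut M l)) = rotAut M (rotAut M l)
      conv_lhs => rw [← h l hl]
      simp

theorem apply_one_eq_of_apply_two {k : PermTriple M} (hk : k ∈ autotopisms M)
    (h : ∀ x, c x 1 → k.2.1 x = x) {x : M} (hx : c x 1) : k.1 x = k.1 1 * x := by
  have h1 := hk 1 x
  have h2 := hk x 1
  rw [h x hx, one_mul] at h1
  rw [h 1 (c.refl 1), mul_one, mul_one] at h2
  rw [h1, h2]

theorem IsMinInvariant.exists_isDirectPowerOf [Finite M] (hK : IsMinInvariant c K)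
    (h𝒯 : IsFactorSet K 𝒯)
    (hfix : ∀ U ∈ 𝒯, oppAut M • U = U → rotAut M • U = U → ∀ k ∈ U, ∀ x, c x 1 → k.1 x = x)
    {T : Subgroup (PermTriple M)} (hT : T ∈ 𝒯) :
    (∃ k, @IsDirectPowerOf M _ {x | c x 1} k T (ofGroup T)) ∧
      ∀ x, c x 1 → ∀ y, c y 1 → ∀ z, c z 1 → (x * y) * z = x * (y * z) := by
  classical
  have hcK : ∀ k ∈ K, ∀ x, c x 1 → c (k.1 x) 1 := fun k hk x hx =>
    c.trans (hK.con_apply k hk x) hx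
  let ι := {U // U ∈ 𝒯 ∧ (∀ k ∈ U, ∀ x, c x 1 → k.2.1 x = x) ∧
    ¬ ∀ k ∈ U, ∀ x, c x 1 → k.1 x = x}
  let := Fintype.ofFinite ι
  let H : ι → Subgroup (PermTriple M) := fun i => i.1
  have hcomm : Pairwise fun i j => ∀ x y, x ∈ H i → y ∈ H j → Commute x y :=
    fun i j hij x y hx hy => h𝒯.commute _ i.2.1 _ j.2.1 (fun h => hij (Subtype.ext h)) x hx y hy
  let φ := Subgroup.noncommPiCoprod hcomm
  let C : Subgroup (PermTriple M) :=
    { carrier := {k | k ∈ K ∧ ∀ x, c x 1 → k.2.1 x = x}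
      one_mem' := ⟨one_mem _, fun _ _ => rfl⟩
      mul_mem' := fun {k l} hk hl => ⟨mul_mem hk.1 hl.1, fun x hx => by
        change k.2.1 (l.2.1 x) = x
        rw [hl.2 x hx, hk.2 x hx]⟩
      inv_mem' := fun {k} hk => ⟨inv_mem hk.1, fun x hx => by
        change k.2.1⁻¹ x = x
        rw [Equiv.Perm.inv_eq_iff_eq, hk.2 x hx]⟩ }
  let Z : Subgroup (PermTriple M) :=
    { carrier := {k | k ∈ K ∧ ∀ x, c x 1 → k.1 x = x}
      one_mem' := ⟨one_mem _, fun _ _ => rfl⟩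
      mul_mem' := fun {k l} hk hl => ⟨mul_mem hk.1 hl.1, fun x hx => by
        change k.1 (l.1 x) = x
        rw [hl.2 x hx, hk.2 x hx]⟩
      inv_mem' := fun {k} hk => ⟨inv_mem hk.1, fun x hx => by
        change k.1⁻¹ x = x
        rw [Equiv.Perm.inv_eq_iff_eq, hk.2 x hx]⟩ }
  have hHK : ∀ i, H i ≤ K := fun i => (h𝒯.isMinNormal _ i.2.1).le
  have hφC : φ.range ≤ C := by
    rw [Subgroup.noncommPiCoprod_range, iSup_le_iff]
    exact fun i k hk => ⟨hHK i hk, i.2.2.1 k hk⟩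
  have hmem : ∀ i, H i ≤ φ.range := by
    intro i
    rw [Subgroup.noncommPiCoprod_range]
    exact le_iSup H i
  have hleft : ∀ k ∈ C, ∀ x, c x 1 → k.1 x = k.1 1 * x := fun k hk x hx =>
    apply_one_eq_of_apply_two (hK.le_autotopisms hk.1) hk.2 hx
  have hZn : ∀ k ∈ K, ∀ z ∈ Z, k * z * k⁻¹ ∈ Z := fun k hk z hz =>
    ⟨mul_mem (mul_mem hk hz.1) (inv_mem hk), fun x hx => by
      change k.1 (z.1 (k⁻¹.1 x)) = x
      rw [hz.2 _ (hcK _ (inv_mem hk) x hx)]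
      exact k.1.apply_symm_apply x⟩
  have hker : ∀ w, φ w ∈ Z → w = 1 := by
    intro w hw
    refine eq_one_of_noncommPiCoprod_mem hcomm (fun i => h𝒯.simple _ i.2.1) ?_
      (fun i u hu z hz => hZn u (hHK i hu) z hz) hw
    intro i u hu huZ
    rcases (h𝒯.isMinNormal _ i.2.1).minimal (H i ⊓ Z) inf_le_left (fun k hk y hy =>
      ⟨(h𝒯.isMinNormal _ i.2.1).normal k hk y hy.1, hZn k hk y hy.2⟩) with h | h
    · exact (Subgroup.mem_bot).1 (h ▸ (⟨hu, huZ⟩ : u ∈ H i ⊓ Z))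
    · refine absurd (fun k hk => ?_) i.2.2.2
      exact ((inf_eq_left.1 h) hk).2
  have hstep : ∀ U ∈ 𝒯, ∀ u ∈ U, ∀ k, (∃ b ∈ φ.range, k.1 1 = b.1 1) →
      ∃ b ∈ φ.range, (u * k).1 1 = b.1 1 := by
    rintro U hU u hu k ⟨b, hb, hkb⟩
    have hbN : c (b.1 1) 1 := hcK b (hφC hb).1 1 (c.refl 1)
    by_cases h1 : ∀ k ∈ U, ∀ x, c x 1 → k.1 x = x
    · refine ⟨b, hb, ?_⟩
      rw [Prod.fst_mul, Equiv.Perm.mul_apply, hkb, h1 u hu _ hbN]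
    by_cases h2 : ∀ k ∈ U, ∀ x, c x 1 → k.2.1 x = x
    · refine ⟨u * b, mul_mem (hmem ⟨U, hU, h2, h1⟩ hu) hb, ?_⟩
      rw [Prod.fst_mul, Prod.fst_mul, Equiv.Perm.mul_apply, hkb, Equiv.Perm.mul_apply]
    have h3 := ((hK.apply_eq_of_factor h𝒯 hU (hfix U hU)).resolve_left h1).resolve_left h2
    let r : MulAut (PermTriple M) := rotAut M * rotAut M * oppAut M
    have hr : ∀ k, r k = (invConj M k.1, k.2.2, k.2.1) := fun k => by simp [r]
    have hrU : r • U ∈ 𝒯 := h𝒯.smul_mem _ (mul_mem (mul_mem rotAut_mem_trialityGroup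
      rotAut_mem_trialityGroup) oppAut_mem_trialityGroup) U hU
    have hru : r u ∈ φ.range := by
      refine hmem ⟨r • U, hrU, ?_, fun h => h1 fun k hk x hx => ?_⟩
        (Subgroup.smul_mem_pointwise_smul u r U hu)
      · rintro _ ⟨k, hk, rfl⟩ x hx
        change (r k).2.1 x = x
        rw [hr]
        exact h3 k hk x hx
      · have e := h (r k) (Subgroup.smul_mem_pointwise_smul k r U hk) (inv x)
          (by simpa only [inv_one] using con_inv c hx)
        rw [hr, invConj_apply, inv_inv] at e
        rw [← inv_inv (k.1 x), e, inv_inv]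
    have hu1 : u.1 1 = (r u)⁻¹.1 1 := by
      have e := hleft _ (hφC (inv_mem hru)) ((r u).1 1) (hcK _ (hφC hru).1 1 (c.refl 1))
      change (r u).1.symm ((r u).1 1) = _ at e
      rw [Equiv.symm_apply_apply, hr, invConj_apply, inv_one, ← hr] at e
      exact mul_right_cancel' (a := inv (u.1 1)) ((mul_inv _).trans e)
    have hub : u * b = b * u := by
      have hle : φ.range ≤ Subgroup.centralizer {u} := by
        rw [Subgroup.noncommPiCoprod_range, iSup_le_iff]
        intro i l hl
        rw [Subgroup.mem_centralizer_singleton_iff]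
        refine (h𝒯.commute _ hU _ i.2.1 (fun h => h2 ?_) u hu l hl).symm
        rw [h]
        exact i.2.2.1
      exact (Subgroup.mem_centralizer_singleton_iff.1 (hle hb)).symm
    refine ⟨b * (r u)⁻¹, mul_mem hb (inv_mem hru), ?_⟩
    have e : (u * k).1 1 = (u * b).1 1 := by
      rw [Prod.fst_mul, Prod.fst_mul, Equiv.Perm.mul_apply, hkb, Equiv.Perm.mul_apply]
    rw [e, hub, Prod.fst_mul, Prod.fst_mul, Equiv.Perm.mul_apply, hu1, Equiv.Perm.mul_apply]
  have hsurj : ∀ x, c x 1 → ∃ b ∈ φ.range, b.1 1 = x := by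
    intro x hx
    obtain ⟨k, hk, rfl⟩ := hK.exists_apply_one x hx
    have hP : ∃ b ∈ φ.range, k.1 1 = b.1 1 := by
      clear hx
      rw [← h𝒯.closure_eq] at hk
      induction hk using Subgroup.closure_induction_left with
      | one => exact ⟨1, one_mem _, rfl⟩
      | mul_left u hu k _ ih =>
        obtain ⟨U, hU, hu⟩ := hu
        exact hstep U hU u hu k ih
      | inv_mul_cancel u hu k _ ih =>
        obtain ⟨U, hU, hu⟩ := hu
        exact hstep U hU _ (inv_mem hu) k ih
    obtain ⟨b, hb, h⟩ := hP
    exact ⟨b, hb, h.symm⟩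
  refine ⟨?_, ?_⟩
  · have he : ∀ i, Nonempty (T ≃* H i) := by
      intro i
      obtain ⟨a, ha⟩ := h𝒯.exists_smul_eq T hT _ i.2.1
      exact ⟨(Subgroup.equivSMul a T).trans (MulEquiv.subgroupCongr ha)⟩
    refine exists_isDirectPowerOf_of_pi (fun i => (he i).some) (fun w => (φ w).1 1) ?_ ?_ ?_
    · intro w v h
      have hC : φ (v⁻¹ * w) ∈ C := hφC ⟨_, rfl⟩
      have h1 : (φ (v⁻¹ * w)).1 1 = 1 := by
        rw [map_mul, map_inv, Prod.fst_mul, Equiv.Perm.mul_apply]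
        change (φ v).1⁻¹ ((φ w).1 1) = 1
        rw [Equiv.Perm.inv_eq_iff_eq]
        exact h
      have h2 := hker _ (show φ (v⁻¹ * w) ∈ Z from ⟨hC.1, fun x hx => by
        rw [hleft _ hC x hx, h1, one_mul]⟩)
      exact (inv_mul_eq_one.1 h2).symm
    · ext x
      constructor
      · rintro ⟨w, rfl⟩
        exact hcK _ (hφC ⟨w, rfl⟩).1 1 (c.refl 1)
      · intro hx
        obtain ⟨_, ⟨w, rfl⟩, h⟩ := hsurj x hx
        exact ⟨w, h⟩
    · intro u v
      have hv := hcK _ (hφC ⟨v, rfl⟩).1 1 (c.refl 1)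
      change (φ (u * v)).1 1 = _
      rw [map_mul, Prod.fst_mul, Equiv.Perm.mul_apply]
      exact hleft _ (hφC ⟨u, rfl⟩) _ hv
  · intro x hx y hy z hz
    obtain ⟨a, ha, rfl⟩ := hsurj x hx
    obtain ⟨b, hb, rfl⟩ := hsurj y hy
    have hbC := hφC hb
    have e := hleft _ (mul_mem (hφC ha) hbC) z hz
    rw [Prod.fst_mul, Equiv.Perm.mul_apply, Equiv.Perm.mul_apply, hleft b hbC z hz,
      hleft a (hφC ha) _ hy, hleft a (hφC ha) _ ((isSubloopSet_con c).2.1 _ hy _ hz)] at e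
    exact e.symm

end Semiregular

end MoufangLoop

namespace MoufangLoop

section Subloop

variable {M : Type*} [MoufangLoop M] {N : Set M}

/-- The Moufang loop structure of a subloop. -/
@[reducible]
def IsSubloopSet.moufangLoop (hN : IsSubloopSet N) : MoufangLoop N where
  mul x y := ⟨x * y, hN.2.1 x x.2 y y.2⟩
  one := ⟨1, hN.1⟩
  one_mul _ := Subtype.ext (one_mul _)
  mul_one _ := Subtype.ext (mul_one _)
  existsUnique_mul_left a b := ⟨⟨lsol a b, hN.2.2.1 a a.2 b b.2⟩, Subtype.ext (mul_lsol _ _),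
    fun _ h => Subtype.ext (mul_left_cancel' ((congrArg Subtype.val h).trans (mul_lsol _ _).symm))⟩
  existsUnique_mul_right a b := ⟨⟨rsol a b, hN.2.2.2 a a.2 b b.2⟩, Subtype.ext (rsol_mul _ _),
    fun _ h => Subtype.ext (mul_right_cancel' ((congrArg Subtype.val h).trans (rsol_mul _ _).symm))⟩
  moufang _ _ _ := Subtype.ext (moufang _ _ _)

theorem IsSubloopSet.isSimpleLoop (hN : IsSubloopSet N)
    (h : ∀ D : Set M, IsSubloopSet D → IsNormalIn D N → D = ({1} : Set M) ∨ D = N) :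
    @IsSimpleLoop N hN.moufangLoop := by
  let := hN.moufangLoop
  let f : N →ₙ* M := ⟨Subtype.val, fun _ _ => rfl⟩
  have hf : Function.Injective f := Subtype.val_injective
  intro D hD hDn
  have hs : IsSubloopSet (f '' D) := by
    refine ⟨⟨1, hD.1, rfl⟩, ?_, ?_, ?_⟩
    · rintro _ ⟨x, hx, rfl⟩ _ ⟨y, hy, rfl⟩
      exact ⟨x * y, hD.2.1 x hx y hy, rfl⟩
    · rintro _ ⟨x, hx, rfl⟩ _ ⟨y, hy, rfl⟩
      refine ⟨lsol x y, hD.2.2.1 x hx y hy, mul_left_cancel' (a := f x) ?_⟩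
      rw [mul_lsol, ← map_mul, mul_lsol]
    · rintro _ ⟨x, hx, rfl⟩ _ ⟨y, hy, rfl⟩
      refine ⟨rsol x y, hD.2.2.2 x hx y hy, mul_right_cancel' (a := f x) ?_⟩
      rw [rsol_mul, ← map_mul, rsol_mul]
  have hn : IsNormalIn (f '' D) N := by
    refine ⟨?_, fun x hx => ?_, fun x hx y hy => ?_, fun x hx y hy => ?_⟩
    · rintro _ ⟨x, -, rfl⟩
      exact x.2
    · have e := congrArg (f '' ·) (hDn.2.1 ⟨x, hx⟩ trivial)
      simp only [Set.image_mul, Set.image_singleton] at e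
      exact e
    · have e := congrArg (f '' ·) (hDn.2.2.1 ⟨x, hx⟩ trivial ⟨y, hy⟩ trivial)
      simp only [Set.image_mul, Set.image_singleton] at e
      exact e
    · have e := congrArg (f '' ·) (hDn.2.2.2 ⟨x, hx⟩ trivial ⟨y, hy⟩ trivial)
      simp only [Set.image_mul, Set.image_singleton] at e
      exact e
  rcases h _ hs hn with h | h
  · left
    refine hf.image_injective (h.trans ?_)
    rw [Set.image_singleton]
    rfl
  · right
    refine hf.image_injective (h.trans ?_)
    rw [Set.image_univ]
    exact Subtype.range_coe.symm

theorem IsSubloopSet.isDirectPowerOf_self (hN : IsSubloopSet N) :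
    @IsDirectPowerOf M _ N 1 N hN.moufangLoop := by
  refine ⟨fun w => w 0, fun u v h => ?_, ?_, fun u v => rfl⟩
  · refine funext fun i => ?_
    rw [Subsingleton.elim i 0]
    exact Subtype.ext h
  · refine Set.Subset.antisymm ?_ fun x hx => ⟨fun _ => ⟨x, hx⟩, rfl⟩
    rintro _ ⟨w, rfl⟩
    exact (w 0).2

end Subloop

end MoufangLoop

/-- A minimal normal subloop `N` of a finite Moufang loop is the direct product of
pairwise isomorphic simple loops; if moreover `N` is nonassociative, then `N` is simple. -/
theorem minimal_normal_subloop_structure (M : Type) [MoufangLoop M] [Finite M] (N : Set M)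
    (hN : MoufangLoop.IsSubloopSet N) (hNn : MoufangLoop.IsNormalIn N Set.univ)
    (hNne : N ≠ ({1} : Set M))
    (hmin : ∀ D : Set M, MoufangLoop.IsSubloopSet D → MoufangLoop.IsNormalIn D Set.univ →
      D ⊆ N → D = ({1} : Set M) ∨ D = N) :
    (∃ (k : ℕ) (L : Type) (iL : MoufangLoop L),
      @MoufangLoop.IsSimpleLoop L iL ∧ @MoufangLoop.IsDirectPowerOf M _ N k L iL) ∧
    ((¬ ∀ x ∈ N, ∀ y ∈ N, ∀ z ∈ N, (x * y) * z = x * (y * z)) →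
      ∀ D : Set M, MoufangLoop.IsSubloopSet D → MoufangLoop.IsNormalIn D N →
        D = ({1} : Set M) ∨ D = N) := by
  open MoufangLoop in
  obtain ⟨c, hc⟩ := exists_con hN hNn
  obtain rfl : {x | c x 1} = N := Set.ext hc
  have hne : ∃ x, x ≠ 1 ∧ c x 1 := by
    by_contra! h
    exact hNne (Set.Subset.antisymm (fun x hx => by_contra fun hx1 => h x hx1 hx)
      (Set.singleton_subset_iff.2 (c.refl 1)))
  obtain ⟨K, hK⟩ := exists_isMinInvariant c hne fun d hd => by
    rcases hmin {x | d x 1} (isSubloopSet_con d) (isNormalIn_con d) fun x hx => hd hx with h | h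
    · exact Or.inl fun x hx => h.subset hx
    · exact Or.inr fun x hx => h.symm.subset hx
  by_cases hcomm : ∀ k ∈ K, ∀ l ∈ K, k * l = l * k
  · have hassoc : ∀ x ∈ {x | c x 1}, ∀ y ∈ {x | c x 1}, ∀ z ∈ {x | c x 1},
        (x * y) * z = x * (y * z) := fun x hx y _ z hz =>
      hK.mul_assoc_of_commutative hcomm hx hz y
    refine ⟨?_, fun h => absurd hassoc h⟩
    obtain ⟨p, hp, hpow⟩ := hK.exists_prime_pow_eq_one hcomm
    have : Fact p.Prime := ⟨hp⟩
    obtain ⟨k, hk⟩ := hN.exists_isDirectPowerOf_zmod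
      (fun x hx y hy => hK.mul_comm_of_commutative hcomm hx hy) hassoc fun x hx =>
        congrArg (fun m : PermTriple M => m.1 1) (hpow _ (hK.moufangTriple_mem hx))
    exact ⟨k, _, _, isSimpleLoop_multiplicative_zmod p, hk⟩
  obtain ⟨𝒯, h𝒯⟩ := hK.exists_isFactorSet hcomm
  by_cases hfix : ∀ U ∈ 𝒯, oppAut M • U = U → rotAut M • U = U →
      ∀ k ∈ U, ∀ x, c x 1 → k.1 x = x
  · obtain ⟨T, hT⟩ : 𝒯.Nonempty := by
      by_contra h
      have e := h𝒯.closure_eq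
      simp [Set.not_nonempty_iff_eq_empty.1 h] at e
      exact hK.ne_bot e.symm
    obtain ⟨⟨k, hk⟩, hassoc⟩ := hK.exists_isDirectPowerOf h𝒯 hfix hT
    exact ⟨⟨k, T, _, isSimpleLoop_of_isNonabelianSimple (h𝒯.simple T hT), hk⟩,
      fun h => absurd hassoc h⟩
  · push Not at hfix
    obtain ⟨U, hU, htU, hρU, hUne⟩ := hfix
    obtain rfl := hK.eq_of_smul_eq h𝒯 hU htU hρU hUne
    have hsimple : ∀ D : Set M, IsSubloopSet D → IsNormalIn D {x | c x 1} →
        D = {1} ∨ D = {x | c x 1} := fun D hD hDn =>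
      hK.eq_one_or_eq (h𝒯.simple _ hU) hne hD hDn
    exact ⟨⟨1, _, hN.moufangLoop, hN.isSimpleLoop hsimple, hN.isDirectPowerOf_self⟩,
      fun _ => hsimple⟩
end

section
/- Let the symmetric group S₄ act on a direct product G = G₁ × G₂ × G₃ × G₄ of pairwise isomorphic groups in such a way that (G_i)^τ = G_{i^τ} for all i = 1, …, 4 and all τ ∈ S₄. Write S₄ = S ⋉ N, where S = ⟨σ = (12), ρ = (123)⟩ and N = ⟨(12)(34), (13)(24)⟩. If the semidirect product N ⋉ G (with the automorphisms σ, ρ acting on N ⋉ G induced by the S₄-action) is a group with triality S, then G₄ ≤ C_G(S). -/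
/-- A group `H` together with two maps `r, s` is a group with triality `S = ⟨r, s⟩`:
`r, s` are automorphisms with `r³ = s² = (rs)² = 1` satisfying the triality identity. -/
def IsTrialityFun (H : Type*) [Group H] (r s : H → H) : Prop :=
  (∀ x y : H, r (x * y) = r x * r y) ∧ (∀ x y : H, s (x * y) = s x * s y) ∧
    Function.Bijective r ∧ Function.Bijective s ∧
    (∀ x, r (r (r x)) = x) ∧ (∀ x, s (s x) = x) ∧ (∀ x, r (s (r (s x))) = x) ∧
    ∀ x : H, (x⁻¹ * s x) * r (x⁻¹ * s x) * r (r (x⁻¹ * s x)) = 1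

section S4

variable (Gf : Fin 4 → Type) [∀ i, Group (Gf i)]

/-- The `i`-th factor of the direct product `G₁ × G₂ × G₃ × G₄`. -/
def factorSub (i : Fin 4) : Subgroup (∀ j, Gf j) where
  carrier := {p | ∀ j, j ≠ i → p j = 1}
  one_mem' := fun _ _ => rfl
  mul_mem' := by
    intro a b ha hb j hj
    have := ha j hj
    have := hb j hj
    simp_all [Pi.mul_apply]
  inv_mem' := by
    intro a ha j hj
    have := ha j hj
    simp_all [Pi.inv_apply]

/-- The transposition `σ = (12)` (on indices `0,…,3`). -/
def sigP : Equiv.Perm (Fin 4) := Equiv.swap 0 1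

/-- The 3-cycle `ρ = (123)` (on indices `0,…,3`). -/
def rhoP : Equiv.Perm (Fin 4) := Equiv.swap 0 2 * Equiv.swap 0 1

/-- The Klein subgroup `N = ⟨(12)(34), (13)(24)⟩` of `S₄`. -/
def klein : Subgroup (Equiv.Perm (Fin 4)) :=
  Subgroup.closure {Equiv.swap 0 1 * Equiv.swap 2 3, Equiv.swap 0 2 * Equiv.swap 1 3}

theorem conj_mem_klein (τ : Equiv.Perm (Fin 4))
    (h1 : τ * (Equiv.swap 0 1 * Equiv.swap 2 3) * τ⁻¹ ∈ klein)
    (h2 : τ * (Equiv.swap 0 2 * Equiv.swap 1 3) * τ⁻¹ ∈ klein) :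
    ∀ n ∈ klein, τ * n * τ⁻¹ ∈ klein := by
  intro n hn
  induction hn using Subgroup.closure_induction with
  | mem g hg =>
    rcases hg with hg | hg
    · rw [hg]; exact h1
    · rw [hg]; exact h2
  | one => simpa using Subgroup.one_mem klein
  | mul a b _ _ ha hb =>
    have : τ * (a * b) * τ⁻¹ = (τ * a * τ⁻¹) * (τ * b * τ⁻¹) := by group
    rw [this]
    exact Subgroup.mul_mem _ ha hb
  | inv a _ ha =>
    have : τ * a⁻¹ * τ⁻¹ = (τ * a * τ⁻¹)⁻¹ := by group
    rw [this]
    exact Subgroup.inv_mem _ ha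

theorem gen1_mem : Equiv.swap 0 1 * Equiv.swap 2 3 ∈ klein :=
  Subgroup.subset_closure (Set.mem_insert _ _)

theorem gen2_mem : Equiv.swap 0 2 * Equiv.swap 1 3 ∈ klein :=
  Subgroup.subset_closure (Set.mem_insert_of_mem _ rfl)

theorem sig_conj_mem : ∀ n ∈ klein, sigP * n * sigP⁻¹ ∈ klein := by
  apply conj_mem_klein
  · have : sigP * (Equiv.swap 0 1 * Equiv.swap 2 3) * sigP⁻¹
        = Equiv.swap 0 1 * Equiv.swap 2 3 := by decide
    rw [this]; exact gen1_mem
  · have : sigP * (Equiv.swap 0 2 * Equiv.swap 1 3) * sigP⁻¹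
        = (Equiv.swap 0 1 * Equiv.swap 2 3) * (Equiv.swap 0 2 * Equiv.swap 1 3) := by decide
    rw [this]; exact Subgroup.mul_mem _ gen1_mem gen2_mem

theorem rho_conj_mem : ∀ n ∈ klein, rhoP * n * rhoP⁻¹ ∈ klein := by
  apply conj_mem_klein
  · have : rhoP * (Equiv.swap 0 1 * Equiv.swap 2 3) * rhoP⁻¹
        = (Equiv.swap 0 1 * Equiv.swap 2 3) * (Equiv.swap 0 2 * Equiv.swap 1 3) := by decide
    rw [this]; exact Subgroup.mul_mem _ gen1_mem gen2_mem
  · have : rhoP * (Equiv.swap 0 2 * Equiv.swap 1 3) * rhoP⁻¹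
        = Equiv.swap 0 1 * Equiv.swap 2 3 := by decide
    rw [this]; exact gen1_mem

variable (φ : Equiv.Perm (Fin 4) →* MulAut (∀ j, Gf j))

/-- The semidirect product `N ⋉ G`, where the Klein group `N` acts via `φ`. -/
abbrev KleinExt : Type _ := SemidirectProduct (∀ j, Gf j) ↥klein (φ.comp klein.subtype)

/-- The map induced by `ρ = (123)` on `N ⋉ G`. -/
def rhoStar : KleinExt Gf φ → KleinExt Gf φ := fun x =>
  ⟨φ rhoP x.left, ⟨rhoP * (x.right : Equiv.Perm (Fin 4)) * rhoP⁻¹, rho_conj_mem _ x.right.2⟩⟩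

/-- The map induced by `σ = (12)` on `N ⋉ G`. -/
def sigmaStar : KleinExt Gf φ → KleinExt Gf φ := fun x =>
  ⟨φ sigP x.left, ⟨sigP * (x.right : Equiv.Perm (Fin 4)) * sigP⁻¹, sig_conj_mem _ x.right.2⟩⟩

end S4

section

variable {Gf : Fin 4 → Type} [∀ i, Group (Gf i)] {φ : Equiv.Perm (Fin 4) →* MulAut (∀ j, Gf j)}

theorem rhoStar_inl (g : ∀ j, Gf j) :
    rhoStar Gf φ (SemidirectProduct.inl g) = SemidirectProduct.inl (φ rhoP g) := by
  ext <;> simp [rhoStar]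

theorem sigmaStar_inl (g : ∀ j, Gf j) :
    sigmaStar Gf φ (SemidirectProduct.inl g) = SemidirectProduct.inl (φ sigP g) := by
  ext <;> simp [sigmaStar]

/-- The triality identity restricted to the normal subgroup `G` of `N ⋉ G`. -/
theorem IsTrialityFun.base_identity
    (htri : IsTrialityFun (KleinExt Gf φ) (rhoStar Gf φ) (sigmaStar Gf φ)) (g : ∀ j, Gf j) :
    (g⁻¹ * φ sigP g) * φ rhoP (g⁻¹ * φ sigP g) * φ rhoP (φ rhoP (g⁻¹ * φ sigP g)) = 1 := by
  have h := htri.2.2.2.2.2.2.2 (SemidirectProduct.inl g)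
  simp only [sigmaStar_inl, ← map_inv, ← map_mul, rhoStar_inl] at h
  exact SemidirectProduct.inl_injective (h.trans (map_one _).symm)

theorem apply_mem_factorSub
    (hfact : ∀ (τ : Equiv.Perm (Fin 4)) (i : Fin 4),
      (factorSub Gf i).map (φ τ).toMonoidHom = factorSub Gf (τ i))
    (τ : Equiv.Perm (Fin 4)) {i : Fin 4} {g : ∀ j, Gf j} (hg : g ∈ factorSub Gf i) :
    φ τ g ∈ factorSub Gf (τ i) :=
  hfact τ i ▸ Subgroup.mem_map_of_mem (φ τ).toMonoidHom hg

theorem swap_one_two_apply_of_mem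
    (hfact : ∀ (τ : Equiv.Perm (Fin 4)) (i : Fin 4),
      (factorSub Gf i).map (φ τ).toMonoidHom = factorSub Gf (τ i))
    (htri : IsTrialityFun (KleinExt Gf φ) (rhoStar Gf φ) (sigmaStar Gf φ))
    {g : ∀ j, Gf j} (hg : g ∈ factorSub Gf 0) : φ (Equiv.swap 1 2) g = g := by
  have h := congrFun (htri.base_identity g) 0
  simp only [map_mul, map_inv, ← MulAut.mul_apply, Pi.mul_apply, Pi.inv_apply, Pi.one_apply] at h
  simp only [← map_mul] at h
  have vanish (τ : Equiv.Perm (Fin 4)) (hτ : 0 ≠ τ 0) : φ τ g 0 = 1 :=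
    apply_mem_factorSub hfact τ hg 0 hτ
  rw [vanish sigP (by decide), vanish rhoP (by decide), vanish (rhoP * sigP) (by decide),
    vanish (rhoP * rhoP) (by decide),
    show rhoP * (rhoP * sigP) = Equiv.swap 1 2 by decide] at h
  funext j
  by_cases hj : j = 0
  · subst hj
    exact (inv_mul_eq_one.mp (by simpa using h)).symm
  · exact (apply_mem_factorSub hfact (Equiv.swap 1 2) hg j hj).trans (hg j hj).symm

/-- Every transposition obtained from `(23)` by a permutation moving index `0` to `i` acts
trivially on the `i`-th factor. -/
theorem conj_swap_apply_of_mem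
    (hfact : ∀ (τ : Equiv.Perm (Fin 4)) (i : Fin 4),
      (factorSub Gf i).map (φ τ).toMonoidHom = factorSub Gf (τ i))
    (htri : IsTrialityFun (KleinExt Gf φ) (rhoStar Gf φ) (sigmaStar Gf φ))
    (τ : Equiv.Perm (Fin 4)) {g : ∀ j, Gf j} (hg : g ∈ factorSub Gf (τ 0)) :
    φ (τ * Equiv.swap 1 2 * τ⁻¹) g = g := by
  have hmem : φ τ⁻¹ g ∈ factorSub Gf 0 := by
    simpa using apply_mem_factorSub hfact τ⁻¹ hg
  rw [map_mul, map_mul, MulAut.mul_apply, MulAut.mul_apply,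
    swap_one_two_apply_of_mem hfact htri hmem, ← MulAut.mul_apply, ← map_mul,
    mul_inv_cancel, map_one, MulAut.one_apply]

end

theorem paige_S4_triality_factor_fixed (Gf : Fin 4 → Type) [∀ i, Group (Gf i)]
    (hiso : ∀ i j : Fin 4, Nonempty (Gf i ≃* Gf j))
    (φ : Equiv.Perm (Fin 4) →* MulAut (∀ j, Gf j))
    (hfact : ∀ (τ : Equiv.Perm (Fin 4)) (i : Fin 4),
      (factorSub Gf i).map (φ τ).toMonoidHom = factorSub Gf (τ i))
    (htri : IsTrialityFun (KleinExt Gf φ) (rhoStar Gf φ) (sigmaStar Gf φ)) :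
    ∀ g ∈ factorSub Gf 3, φ sigP g = g ∧ φ rhoP g = g := by
  intro g hg
  have fixed (τ : Equiv.Perm (Fin 4)) (hτ : τ 0 = 3) : φ (τ * Equiv.swap 1 2 * τ⁻¹) g = g :=
    conj_swap_apply_of_mem hfact htri τ (hτ.symm ▸ hg)
  have h01 : φ (Equiv.swap 0 1) g = g := by
    rw [show (Equiv.swap 0 1 : Equiv.Perm (Fin 4)) = (Equiv.swap 0 3 * Equiv.swap 2 3) *
      Equiv.swap 1 2 * (Equiv.swap 0 3 * Equiv.swap 2 3)⁻¹ by decide]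
    exact fixed _ (by decide)
  have h02 : φ (Equiv.swap 0 2) g = g := by
    rw [show (Equiv.swap 0 2 : Equiv.Perm (Fin 4)) = (Equiv.swap 0 3 * Equiv.swap 1 3) *
      Equiv.swap 1 2 * (Equiv.swap 0 3 * Equiv.swap 1 3)⁻¹ by decide]
    exact fixed _ (by decide)
  exact ⟨h01, by rw [rhoP, map_mul, MulAut.mul_apply, h01, h02]⟩
end
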